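/- arXiv:math/0205240 — 4 statements merged into one kernel-verified Lean document; each statement's English description precedes it below -/
import Mathlib

section
/- If ω ∈ Λ³V* is a 3-form with λ(ω) ≠ 0, then K_ω ∘ K_ω = λ(ω)·Id_V. -/
open scoped TensorProduct

/-- The wedge product of alternating forms with values in a commutative algebra `A`
(determinant/shuffle convention, via `AlternatingMap.domCoprod`). -/
noncomputable def wedge {V : Type*} [AddCommGroup V] [Module ℝ V]
    {A : Type*} [CommRing A] [Algebra ℝ A] {k l : ℕ}
    (α : AlternatingMap ℝ V A (Fin k)) (β : AlternatingMap ℝ V A (Fin l)) :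
    AlternatingMap ℝ V A (Fin (k + l)) :=
  (LinearMap.mul' ℝ A).compAlternatingMap ((α.domCoprod β).domDomCongr finSumFinEquiv)

/-- A covector regarded as an alternating `1`-form. -/
noncomputable def oneForm {V : Type*} [AddCommGroup V] [Module ℝ V]
    {A : Type*} [CommRing A] [Algebra ℝ A] (ξ : V →ₗ[ℝ] A) :
    AlternatingMap ℝ V A (Fin 1) :=
  AlternatingMap.ofSubsingleton ℝ V A (0 : Fin 1) ξ

/-- The wedge product as a normalised sum over all permutations. -/
lemma factorial_mul_wedge_apply {V : Type*} [AddCommGroup V] [Module ℝ V]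
    {A : Type*} [CommRing A] [Algebra ℝ A] {k l : ℕ}
    (α : AlternatingMap ℝ V A (Fin k)) (β : AlternatingMap ℝ V A (Fin l))
    (v : Fin (k + l) → V) :
    (k.factorial * l.factorial) • wedge α β v =
      ∑ σ : Equiv.Perm (Fin (k + l)), Equiv.Perm.sign σ •
        (α (fun i => v (σ (Fin.castAdd l i))) * β (fun i => v (σ (Fin.natAdd k i)))) := by
  have h := congrArg (fun f => LinearMap.mul' ℝ A (f (v ∘ finSumFinEquiv)))
    (MultilinearMap.domCoprod_alternization_eq α β)
  simp only [Fintype.card_fin, AlternatingMap.smul_apply, map_nsmul,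
    MultilinearMap.alternatization_apply, map_sum] at h
  refine h.symm.trans ?_
  refine Fintype.sum_equiv finSumFinEquiv.permCongr _ _ fun σ => ?_
  simp only [Units.smul_def, map_zsmul]
  simp [MultilinearMap.domCoprod_apply, Equiv.permCongr_apply]

lemma sum_perm_fin_succ {M : Type*} [AddCommGroup M] {n : ℕ}
    (f : Equiv.Perm (Fin (n + 1)) → M) :
    ∑ σ, f σ = ∑ p, ∑ τ : Equiv.Perm (Fin n), f (Equiv.Perm.decomposeFin.symm (p, τ)) := by
  rw [← Equiv.Perm.decomposeFin.symm.sum_comp f, Fintype.sum_prod_type]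

lemma sum_sign_smul_map_perm {V N : Type*} [AddCommGroup V] [Module ℝ V] [AddCommGroup N]
    [Module ℝ N] {n : ℕ} (β : AlternatingMap ℝ V N (Fin n)) (v : Fin n → V) :
    ∑ σ : Equiv.Perm (Fin n), Equiv.Perm.sign σ • β (fun i => v (σ i)) = n.factorial • β v := by
  have h := congrArg (· v) (AlternatingMap.coe_alternatization β)
  simpa [MultilinearMap.alternatization_apply] using h

/-- Expansion of `ξ ∧ η` along the argument fed to the covector `ξ`. -/
lemma wedge_oneForm_apply {V : Type*} [AddCommGroup V] [Module ℝ V]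
    (ξ : Module.Dual ℝ V) (η : AlternatingMap ℝ V ℝ (Fin 5)) (v : Fin 6 → V) :
    wedge (oneForm ξ) η v =
      ∑ p, (if p = 0 then 1 else -1) *
        (ξ (v p) * η (fun i => v (Equiv.swap 0 p i.succ))) := by
  have h := factorial_mul_wedge_apply (oneForm ξ) η v
  have hsum : ∀ p : Fin 6, ∑ τ : Equiv.Perm (Fin 5),
      Equiv.Perm.sign (Equiv.Perm.decomposeFin.symm (p, τ)) •
        (oneForm ξ (fun i => v (Equiv.Perm.decomposeFin.symm (p, τ) (Fin.castAdd 5 i))) *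
          η (fun i => v (Equiv.Perm.decomposeFin.symm (p, τ) (Fin.natAdd 1 i)))) =
      120 * ((if p = 0 then 1 else -1) *
        (ξ (v p) * η (fun i => v (Equiv.swap 0 p i.succ)))) := by
    intro p
    have h1 := sum_sign_smul_map_perm η (fun i => v (Equiv.swap 0 p i.succ))
    have hn : ∀ i : Fin 5, Fin.natAdd 1 i = i.succ := fun i => by ext; simp [add_comm]
    simp only [hn, Equiv.Perm.decomposeFin.symm_sign, Equiv.Perm.decomposeFin_symm_apply_succ]
    trans (if p = 0 then 1 else -1) * (ξ (v p) *
      ∑ σ : Equiv.Perm (Fin 5), Equiv.Perm.sign σ • η fun i => v (Equiv.swap 0 p (σ i).succ))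
    · simp only [Finset.mul_sum]
      refine Finset.sum_congr rfl fun τ _ => ?_
      simp only [oneForm, Units.smul_def, zsmul_eq_mul]
      split_ifs <;> simp <;> ring
    · rw [h1, nsmul_eq_mul, show Nat.factorial 5 = 120 from rfl]
      push_cast
      ring
  have h2 := h.trans (sum_perm_fin_succ (n := 5) _)
  rw [Finset.sum_congr rfl fun p _ => hsum p, ← Finset.mul_sum] at h2
  rw [show Nat.factorial 1 * Nat.factorial 5 = 120 from rfl, nsmul_eq_mul] at h2
  push_cast at h2
  linarith

/-- Expansion of `α ∧ β` over the ordered pairs of arguments fed to the `2`-form `α`. -/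
lemma wedge_two_three_apply {V : Type*} [AddCommGroup V] [Module ℝ V]
    (α : AlternatingMap ℝ V ℝ (Fin 2)) (β : AlternatingMap ℝ V ℝ (Fin 3)) (v : Fin 5 → V) :
    2 * wedge α β v =
      ∑ p : Fin 5, ∑ q : Fin 4, (if p = 0 then 1 else -1) * (if q = 0 then 1 else -1) *
        (α ![v p, v (Equiv.swap 0 p q.succ)] *
          β (fun i => v (Equiv.swap 0 p (Equiv.swap 0 q i.succ).succ))) := by
  have h := factorial_mul_wedge_apply α β v
  have hsum : ∀ (p : Fin 5) (q : Fin 4), ∑ τ : Equiv.Perm (Fin 3),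
      Equiv.Perm.sign (Equiv.Perm.decomposeFin.symm (p, Equiv.Perm.decomposeFin.symm (q, τ))) •
        (α (fun i => v (Equiv.Perm.decomposeFin.symm
            (p, Equiv.Perm.decomposeFin.symm (q, τ)) (Fin.castAdd 3 i))) *
          β (fun i => v (Equiv.Perm.decomposeFin.symm
            (p, Equiv.Perm.decomposeFin.symm (q, τ)) (Fin.natAdd 2 i)))) =
      6 * ((if p = 0 then 1 else -1) * (if q = 0 then 1 else -1) *
        (α ![v p, v (Equiv.swap 0 p q.succ)] *
          β (fun i => v (Equiv.swap 0 p (Equiv.swap 0 q i.succ).succ)))) := by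
    intro p q
    have h1 := sum_sign_smul_map_perm β
      (fun i => v (Equiv.swap 0 p (Equiv.swap 0 q i.succ).succ))
    have hn : ∀ i : Fin 3, Fin.natAdd 2 i = i.succ.succ := fun i => by ext; simp; omega
    have hα : ∀ τ : Equiv.Perm (Fin 3), (fun i => v (Equiv.Perm.decomposeFin.symm
        (p, Equiv.Perm.decomposeFin.symm (q, τ)) (Fin.castAdd 3 i))) =
        ![v p, v (Equiv.swap 0 p q.succ)] := by
      intro τ
      ext i
      fin_cases i <;> simp
    simp only [hn, hα, Equiv.Perm.decomposeFin.symm_sign,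
      Equiv.Perm.decomposeFin_symm_apply_succ]
    trans (if p = 0 then 1 else -1) * (if q = 0 then 1 else -1) *
      (α ![v p, v (Equiv.swap 0 p q.succ)] * ∑ σ : Equiv.Perm (Fin 3), Equiv.Perm.sign σ •
        β fun i => v (Equiv.swap 0 p (Equiv.swap 0 q (σ i).succ).succ))
    · simp only [Finset.mul_sum]
      refine Finset.sum_congr rfl fun τ _ => ?_
      simp only [Units.smul_def, zsmul_eq_mul]
      split_ifs <;> simp <;> ring
    · rw [h1, nsmul_eq_mul, show Nat.factorial 3 = 6 from rfl]
      push_cast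
      ring
  have h2 := h.trans (sum_perm_fin_succ (n := 4) _)
  simp_rw [sum_perm_fin_succ (n := 3)] at h2
  rw [Finset.sum_congr rfl fun p _ => Finset.sum_congr rfl fun q _ => hsum p q] at h2
  simp_rw [← Finset.mul_sum] at h2
  rw [show Nat.factorial 2 * Nat.factorial 3 = 12 from rfl, nsmul_eq_mul] at h2
  push_cast at h2
  linarith

lemma exists_basis_extending_pair {V : Type*} [AddCommGroup V] [Module ℝ V]
    [FiniteDimensional ℝ V] (hdim : Module.finrank ℝ V = 6) {v w : V}
    (h : LinearIndependent ℝ ![v, w]) :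
    ∃ b : Module.Basis (Fin 6) ℝ V, b 0 = v ∧ b 1 = w := by
  obtain ⟨x, hx⟩ := exists_linearIndependent_snoc_of_lt_finrank h (by omega)
  obtain ⟨y, hy⟩ := exists_linearIndependent_snoc_of_lt_finrank hx (by omega)
  obtain ⟨z, hz⟩ := exists_linearIndependent_snoc_of_lt_finrank hy (by omega)
  obtain ⟨u, hu⟩ := exists_linearIndependent_snoc_of_lt_finrank hz (by omega)
  refine ⟨basisOfLinearIndependentOfCardEqFinrank hu (by simp [hdim]), ?_, ?_⟩ <;>
    simp only [coe_basisOfLinearIndependentOfCardEqFinrank] <;> rfl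

/-- Matrix entries of the Hitchin endomorphism in a basis, in terms of the values of `ω`. -/
lemma two_mul_coord_hitchin_mul {V : Type*} [AddCommGroup V] [Module ℝ V]
    {θ : AlternatingMap ℝ V ℝ (Fin 6)} {ω : AlternatingMap ℝ V ℝ (Fin 3)} {K : V →ₗ[ℝ] V}
    (hK : ∀ (ξ : Module.Dual ℝ V) (X : V),
      ξ (K X) • θ = wedge (oneForm ξ) (wedge (ω.curryLeft X) ω))
    (b : Module.Basis (Fin 6) ℝ V) (i j : Fin 6) :
    2 * (b.coord j (K (b i)) * θ b) = (if j = 0 then 1 else -1) *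
      ∑ p : Fin 5, ∑ q : Fin 4, (if p = 0 then 1 else -1) * (if q = 0 then 1 else -1) *
        (ω ![b i, b (Equiv.swap 0 j p.succ), b (Equiv.swap 0 j (Equiv.swap 0 p q.succ).succ)] *
          ω ![b (Equiv.swap 0 j (Equiv.swap 0 p (Equiv.swap 0 q 1).succ).succ),
            b (Equiv.swap 0 j (Equiv.swap 0 p (Equiv.swap 0 q 2).succ).succ),
            b (Equiv.swap 0 j (Equiv.swap 0 p (Equiv.swap 0 q 3).succ).succ)]) := by
  have h := congrArg (· b) (hK (b.coord j) (b i))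
  simp only [AlternatingMap.smul_apply, smul_eq_mul] at h
  rw [h, wedge_oneForm_apply, Finset.sum_eq_single j]
  · simp only [Module.Basis.coord_apply, Module.Basis.repr_self, Finsupp.single_eq_same, one_mul]
    rw [mul_left_comm, wedge_two_three_apply]
    congr 1
    refine Finset.sum_congr rfl fun p _ => Finset.sum_congr rfl fun q _ => ?_
    rw [AlternatingMap.curryLeft_apply_apply]
    congr 3
    ext m
    fin_cases m <;> rfl
  · intro p _ hp
    simp [hp]
  · simp

/-- In every basis, the square of the Hitchin endomorphism has a vanishing off-diagonal entry. -/
lemma coord_hitchin_sq_eq_zero {V : Type*} [AddCommGroup V] [Module ℝ V]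
    {θ : AlternatingMap ℝ V ℝ (Fin 6)} (hθ : θ ≠ 0)
    {ω : AlternatingMap ℝ V ℝ (Fin 3)} {K : V →ₗ[ℝ] V}
    (hK : ∀ (ξ : Module.Dual ℝ V) (X : V),
      ξ (K X) • θ = wedge (oneForm ξ) (wedge (ω.curryLeft X) ω))
    (b : Module.Basis (Fin 6) ℝ V) : b.coord 1 (K (K (b 0))) = 0 := by
  have ht : θ b ≠ 0 := (AlternatingMap.map_basis_ne_zero_iff b θ).mpr hθ
  have hsum : b.coord 1 (K (K (b 0))) =
      ∑ j, b.coord j (K (b 0)) * b.coord 1 (K (b j)) := by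
    conv_lhs => rw [← b.sum_repr (K (b 0))]
    simp only [map_sum, map_smul, smul_eq_mul, Module.Basis.coord_apply]
  have hE := two_mul_coord_hitchin_mul hK b
  generalize hw : (fun i j k => ω ![b i, b j, b k]) = w
  have hw' : ∀ i j k, ω ![b i, b j, b k] = w i j k := fun i j k => by rw [← hw]
  have s1 : ∀ i j k, w i j k = - w j i k := by
    intro i j k
    rw [← hw]
    simp only
    rw [← AlternatingMap.map_swap ω _ (i := 0) (j := 1) (by decide)]
    congr 1
    ext m
    fin_cases m <;> rfl
  have s2 : ∀ i j k, w i j k = - w i k j := by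
    intro i j k
    rw [← hw]
    simp only
    rw [← AlternatingMap.map_swap ω _ (i := 1) (j := 2) (by decide)]
    congr 1
    ext m
    fin_cases m <;> rfl
  have z1 : ∀ i k, w i i k = 0 := fun i k => by linarith [s1 i i k]
  have z2 : ∀ i k, w i k k = 0 := fun i k => by linarith [s2 i k k]
  have s1' : ∀ i j k, j < i → w i j k = - w j i k := fun i j k _ => s1 i j k
  have s2' : ∀ i j k, k < j → w i j k = - w i k j := fun i j k _ => s2 i j k
  simp only [hw'] at hE
  generalize hκ : (fun i j => b.coord j (K (b i))) = κ
  have hκ' : ∀ i j, b.coord j (K (b i)) = κ i j := fun i j => by rw [← hκ]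
  simp only [hκ'] at hE hsum
  clear hw hw' hκ hκ'
  have h00 := hE 0 0
  have h01 := hE 0 1
  have h02 := hE 0 2
  have h03 := hE 0 3
  have h04 := hE 0 4
  have h05 := hE 0 5
  have h11 := hE 1 1
  have h21 := hE 2 1
  have h31 := hE 3 1
  have h41 := hE 4 1
  have h51 := hE 5 1
  simp +decide [Fin.sum_univ_succ, Equiv.swap_apply_def, z1, z2, s1', s2']
    at h00 h01 h02 h03 h04 h05 h11 h21 h31 h41 h51
  have hsq : (2 * θ b) ^ 2 * b.coord 1 (K (K (b 0))) =
      ∑ j, (2 * (κ 0 j * θ b)) * (2 * (κ j 1 * θ b)) := by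
    rw [hsum, Finset.mul_sum]
    exact Finset.sum_congr rfl fun j _ => by ring
  have hzero : (2 * θ b) ^ 2 * b.coord 1 (K (K (b 0))) = 0 := by
    rw [hsq, Fin.sum_univ_six,
      h00, h01, h02, h03, h04, h05, h11, h21, h31, h41, h51]
    ring
  exact (mul_eq_zero.mp hzero).resolve_left (by positivity)

/-- For a 3-form `ω` on a 6-dimensional real vector space with Hitchin pfaffian
`λ(ω) ≠ 0`, the Hitchin endomorphism satisfies `K_ω ∘ K_ω = λ(ω) • Id`. -/
theorem hitchin_K_sq_eq_pfaffian_smul_id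
    {V : Type*} [AddCommGroup V] [Module ℝ V] [FiniteDimensional ℝ V]
    (hdim : Module.finrank ℝ V = 6)
    (θ : AlternatingMap ℝ V ℝ (Fin 6)) (hθ : θ ≠ 0)
    (ω : AlternatingMap ℝ V ℝ (Fin 3))
    (K : V →ₗ[ℝ] V)
    (hK : ∀ (ξ : Module.Dual ℝ V) (X : V),
      ξ (K X) • θ = wedge (oneForm ξ) (wedge (ω.curryLeft X) ω))
    (lam : ℝ) (hlam : lam = (1 / 6 : ℝ) * LinearMap.trace ℝ V (K ∘ₗ K))
    (hne : lam ≠ 0) :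
    K ∘ₗ K = lam • LinearMap.id := by
  obtain ⟨a, ha⟩ := LinearMap.exists_eq_smul_id_of_forall_notLinearIndependent
    (f := K ∘ₗ K) fun v hv => by
      obtain ⟨b, h0, h1⟩ := exists_basis_extending_pair hdim hv
      have h := coord_hitchin_sq_eq_zero hθ hK b
      rw [h0, ← LinearMap.comp_apply K K, ← h1] at h
      simp at h
  have : lam = a := by
    rw [hlam, ha, map_smul, LinearMap.trace_one, hdim]
    simp
    ring
  rw [ha, this]
  rfl
end

section
/- For a 3-form ω ∈ Λ³V*: λ(ω) < 0 if and only if ω = α + conj(α) for some decomposable complex 3-form α ∈ Λ³(V* ⊗ ℂ) with α ∧ conj(α) ≠ 0, where conj denotes complex conjugation. Moreover, if λ(ω) < 0 one may take α = (1/2)·(ω + i·|λ(ω)|^{−3/2}·K_ω^*(ω)), i.e. this complex 3-form is decomposable over ℂ. -/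
open scoped TensorProduct

/-- A real-valued alternating form viewed as a complex-valued one. -/
noncomputable def complexify {V : Type*} [AddCommGroup V] [Module ℝ V] {k : ℕ}
    (ω : AlternatingMap ℝ V ℝ (Fin k)) : AlternatingMap ℝ V ℂ (Fin k) :=
  (Algebra.linearMap ℝ ℂ).compAlternatingMap ω

/-- Complex conjugation of a complex-valued alternating form. -/
noncomputable def conjAlt {V : Type*} [AddCommGroup V] [Module ℝ V] {k : ℕ}
    (α : AlternatingMap ℝ V ℂ (Fin k)) : AlternatingMap ℝ V ℂ (Fin k) :=
  (Complex.conjAe.toLinearMap).compAlternatingMap α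

/-- A complex 3-form is decomposable if it is a wedge of three complex covectors. -/
def IsDecomposableC3 {V : Type*} [AddCommGroup V] [Module ℝ V]
    (α : AlternatingMap ℝ V ℂ (Fin 3)) : Prop :=
  ∃ ξ₁ ξ₂ ξ₃ : V →ₗ[ℝ] ℂ,
    α = wedge (oneForm ξ₁) (wedge (oneForm ξ₂) (oneForm ξ₃))

/-- The candidate complex 3-form `α = (1/2)(ω + i·|λ|^{-3/2}·K_ω^*(ω))`. -/
noncomputable def hitchinAlphaNeg {V : Type*} [AddCommGroup V] [Module ℝ V]
    (ω : AlternatingMap ℝ V ℝ (Fin 3)) (K : V →ₗ[ℝ] V) (lam : ℝ) :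
    AlternatingMap ℝ V ℂ (Fin 3) :=
  (2 : ℝ)⁻¹ • (complexify ω +
    |lam| ^ (-(3 / 2) : ℝ) • (Complex.I • complexify (ω.compLinearMap K)))

section Wedge

variable {V : Type*} [AddCommGroup V] [Module ℝ V] {A : Type*} [CommRing A] [Algebra ℝ A]

/-- The product of two multilinear forms in separate groups of variables. -/
noncomputable def mulForms {k l : ℕ} (a : MultilinearMap ℝ (fun _ : Fin k => V) A)
    (b : MultilinearMap ℝ (fun _ : Fin l => V) A) :
    MultilinearMap ℝ (fun _ : Fin (k + l) => V) A :=
  ((LinearMap.mul' ℝ A).compMultilinearMap (a.domCoprod b)).domDomCongr finSumFinEquiv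

theorem mulForms_apply {k l : ℕ} (a : MultilinearMap ℝ (fun _ : Fin k => V) A)
    (b : MultilinearMap ℝ (fun _ : Fin l => V) A) (v : Fin (k + l) → V) :
    mulForms a b v = a (fun i => v (Fin.castAdd l i)) * b (fun i => v (Fin.natAdd k i)) := by
  simp [mulForms]

theorem alternatization_domDomCongr {ι κ N : Type*} [Fintype ι] [DecidableEq ι] [Fintype κ]
    [DecidableEq κ] [AddCommGroup N] [Module ℝ N] (e : ι ≃ κ)
    (m : MultilinearMap ℝ (fun _ : ι => V) N) :
    MultilinearMap.alternatization (m.domDomCongr e) =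
      (MultilinearMap.alternatization m).domDomCongr e := by
  ext v
  simp only [MultilinearMap.alternatization_apply, AlternatingMap.domDomCongr_apply,
    MultilinearMap.domDomCongr_apply]
  refine Fintype.sum_equiv e.symm.permCongr _ _ fun σ => ?_
  simp [Equiv.Perm.sign_permCongr, Equiv.permCongr_apply]

theorem wedge_alternatization {k l : ℕ} (a : MultilinearMap ℝ (fun _ : Fin k => V) A)
    (b : MultilinearMap ℝ (fun _ : Fin l => V) A) :
    wedge (MultilinearMap.alternatization a) (MultilinearMap.alternatization b) =
      MultilinearMap.alternatization (mulForms a b) := by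
  rw [mulForms, alternatization_domDomCongr, LinearMap.compMultilinearMap_alternatization,
    MultilinearMap.domCoprod_alternization]
  rfl

theorem wedge_smul_left {k l : ℕ} (c : ℝ) (a : AlternatingMap ℝ V A (Fin k))
    (b : AlternatingMap ℝ V A (Fin l)) : wedge (c • a) b = c • wedge a b := by
  ext v
  simp only [wedge, ← AlternatingMap.domCoprod'_apply, ← TensorProduct.smul_tmul', map_smul]
  simp

theorem wedge_smul_right {k l : ℕ} (c : ℝ) (a : AlternatingMap ℝ V A (Fin k))
    (b : AlternatingMap ℝ V A (Fin l)) : wedge a (c • b) = c • wedge a b := by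
  ext v
  simp only [wedge, ← AlternatingMap.domCoprod'_apply, TensorProduct.tmul_smul, map_smul]
  simp

theorem alternatization_oneForm (ξ : V →ₗ[ℝ] A) :
    MultilinearMap.alternatization (oneForm ξ : MultilinearMap ℝ (fun _ : Fin 1 => V) A) =
      oneForm ξ := by
  simp [AlternatingMap.coe_alternatization]

theorem wedge_oneForm_wedge (ξ : V →ₗ[ℝ] A) {k l : ℕ} (a : AlternatingMap ℝ V A (Fin k))
    (b : AlternatingMap ℝ V A (Fin l)) (v : Fin (1 + (k + l)) → V) :
    ((k.factorial : ℝ) * l.factorial) • wedge (oneForm ξ) (wedge a b) v =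
      ∑ σ : Equiv.Perm (Fin (1 + (k + l))), Equiv.Perm.sign σ •
        (ξ (v (σ (Fin.castAdd (k + l) 0))) *
          (a (fun i => v (σ (Fin.natAdd 1 (Fin.castAdd l i)))) *
            b (fun i => v (σ (Fin.natAdd 1 (Fin.natAdd k i)))))) := by
  have h : ((k.factorial : ℝ) * l.factorial) • wedge (oneForm ξ) (wedge a b) =
      MultilinearMap.alternatization (mulForms (oneForm ξ : MultilinearMap ℝ _ A)
        (mulForms (a : MultilinearMap ℝ _ A) (b : MultilinearMap ℝ _ A))) := by
    rw [← wedge_alternatization, ← wedge_alternatization, alternatization_oneForm,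
      AlternatingMap.coe_alternatization, AlternatingMap.coe_alternatization,
      ← Nat.cast_smul_eq_nsmul ℝ, ← Nat.cast_smul_eq_nsmul ℝ, wedge_smul_left, wedge_smul_right,
      wedge_smul_right, wedge_smul_right, mul_smul]
    simp
  rw [← AlternatingMap.smul_apply, h, MultilinearMap.alternatization_apply]
  simp [mulForms_apply, oneForm]

/-- The exterior product of a family of covectors, as a determinant. -/
noncomputable def detForm {k : ℕ} (ξ : Fin k → V →ₗ[ℝ] A) : AlternatingMap ℝ V A (Fin k) :=
  MultilinearMap.alternatization
    ((MultilinearMap.mkPiAlgebra ℝ (Fin k) A).compLinearMap ξ)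

theorem detForm_apply {k : ℕ} (ξ : Fin k → V →ₗ[ℝ] A) (v : Fin k → V) :
    detForm ξ v = (Matrix.of fun i j => ξ j (v i)).det := by
  simp [detForm, MultilinearMap.alternatization_apply, Matrix.det_apply]

theorem wedge_detForm {k l : ℕ} (ξ : Fin k → V →ₗ[ℝ] A) (η : Fin l → V →ₗ[ℝ] A) :
    wedge (detForm ξ) (detForm η) = detForm (Fin.append ξ η) := by
  rw [detForm, detForm, wedge_alternatization, detForm]
  congr 1
  ext v
  simp [mulForms_apply, Fin.prod_univ_add]

theorem oneForm_eq_detForm (ξ : V →ₗ[ℝ] A) : oneForm ξ = detForm ![ξ] := by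
  ext v
  simp [detForm_apply, oneForm]

theorem wedge_three_oneForms (ξ₁ ξ₂ ξ₃ : V →ₗ[ℝ] A) :
    wedge (oneForm ξ₁) (wedge (oneForm ξ₂) (oneForm ξ₃)) = detForm ![ξ₁, ξ₂, ξ₃] := by
  simp only [oneForm_eq_detForm, wedge_detForm]
  congr 1
  ext i : 1
  fin_cases i <;> rfl

theorem conjAlt_detForm {k : ℕ} (ξ : Fin k → V →ₗ[ℝ] ℂ) :
    conjAlt (detForm ξ) = detForm fun i => Complex.conjAe.toLinearMap ∘ₗ ξ i := by
  ext v
  simp only [conjAlt, LinearMap.compAlternatingMap_apply, detForm_apply]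
  exact (RingHom.map_det (starRingEnd ℂ) _)

end Wedge

section SignedSum

variable {κ : Type*}

/-- The signed sum of a function over all rearrangements of its arguments. -/
def signedSum {n : ℕ} (F : (Fin n → κ) → ℝ) (u : Fin n → κ) : ℝ :=
  ∑ σ : Equiv.Perm (Fin n), ((Equiv.Perm.sign σ : ℤ) : ℝ) * F (u ∘ σ)

theorem signedSum_succ {n : ℕ} (F : (Fin (n + 1) → κ) → ℝ) (u : Fin (n + 1) → κ) :
    signedSum F u = ∑ p : Fin (n + 1), (if p = 0 then 1 else -1) *
      signedSum (fun w => F (Fin.cons (u p) w)) (fun k => u (Equiv.swap 0 p k.succ)) := by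
  simp only [signedSum, Finset.mul_sum]
  rw [← Finset.sum_product', Finset.univ_product_univ,
    ← Equiv.sum_comp Equiv.Perm.decomposeFin.symm]
  refine Finset.sum_congr rfl fun ⟨p, e⟩ _ => ?_
  have h : u ∘ Equiv.Perm.decomposeFin.symm (p, e) =
      Fin.cons (u p) ((fun k => u (Equiv.swap 0 p k.succ)) ∘ e) := by
    funext x
    refine Fin.cases ?_ (fun x => ?_) x <;> simp
  rw [h, Equiv.Perm.decomposeFin.symm_sign]
  split_ifs <;> simp

/-- The ten shuffles occurring in the product of an alternating `2`-form and an alternating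
`3`-form. -/
def shuffleSum (f : κ → κ → ℝ) (g : κ → κ → κ → ℝ) (a b c d e : κ) : ℝ :=
  f a b * g c d e - f a c * g b d e + f a d * g b c e - f a e * g b c d + f b c * g a d e -
    f b d * g a c e + f b e * g a c d + f c d * g a b e - f c e * g a b d + f d e * g a b c

theorem signedSum_fin_one (F : (Fin 1 → κ) → ℝ) (a : κ) :
    signedSum F ![a] = F ![a] := by
  simp [signedSum, Subsingleton.elim _ (1 : Equiv.Perm (Fin 1))]

theorem signedSum_fin_two (F : (Fin 2 → κ) → ℝ) (a b : κ) :
    signedSum F ![a, b] =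
      signedSum (fun w => F (Fin.cons a w)) ![b] -
      signedSum (fun w => F (Fin.cons b w)) ![a] := by
  rw [signedSum_succ]
  have h (p : Fin 2) : (fun k : Fin 1 => ![a, b] (Equiv.swap 0 p k.succ)) =
      ![![b], ![a]] p := by
    funext k
    fin_cases p <;> fin_cases k <;> rfl
  simp_rw [h]
  simp [Fin.sum_univ_succ, Fin.succ_ne_zero, -Fin.succ_zero_eq_one]
  ring

theorem signedSum_fin_three (F : (Fin 3 → κ) → ℝ) (a b c : κ) :
    signedSum F ![a, b, c] =
      signedSum (fun w => F (Fin.cons a w)) ![b, c] -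
      signedSum (fun w => F (Fin.cons b w)) ![a, c] -
      signedSum (fun w => F (Fin.cons c w)) ![b, a] := by
  rw [signedSum_succ]
  have h (p : Fin 3) : (fun k : Fin 2 => ![a, b, c] (Equiv.swap 0 p k.succ)) =
      ![![b, c], ![a, c], ![b, a]] p := by
    funext k
    fin_cases p <;> fin_cases k <;> rfl
  simp_rw [h]
  simp [Fin.sum_univ_succ, Fin.succ_ne_zero, -Fin.succ_zero_eq_one]
  ring

theorem signedSum_fin_four (F : (Fin 4 → κ) → ℝ) (a b c d : κ) :
    signedSum F ![a, b, c, d] =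
      signedSum (fun w => F (Fin.cons a w)) ![b, c, d] -
      signedSum (fun w => F (Fin.cons b w)) ![a, c, d] -
      signedSum (fun w => F (Fin.cons c w)) ![b, a, d] -
      signedSum (fun w => F (Fin.cons d w)) ![b, c, a] := by
  rw [signedSum_succ]
  have h (p : Fin 4) : (fun k : Fin 3 => ![a, b, c, d] (Equiv.swap 0 p k.succ)) =
      ![![b, c, d], ![a, c, d], ![b, a, d], ![b, c, a]] p := by
    funext k
    fin_cases p <;> fin_cases k <;> rfl
  simp_rw [h]
  simp [Fin.sum_univ_succ, Fin.succ_ne_zero, -Fin.succ_zero_eq_one]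
  ring

theorem signedSum_fin_five (F : (Fin 5 → κ) → ℝ) (a b c d e : κ) :
    signedSum F ![a, b, c, d, e] =
      signedSum (fun w => F (Fin.cons a w)) ![b, c, d, e] -
      signedSum (fun w => F (Fin.cons b w)) ![a, c, d, e] -
      signedSum (fun w => F (Fin.cons c w)) ![b, a, d, e] -
      signedSum (fun w => F (Fin.cons d w)) ![b, c, a, e] -
      signedSum (fun w => F (Fin.cons e w)) ![b, c, d, a] := by
  rw [signedSum_succ]
  have h (p : Fin 5) : (fun k : Fin 4 => ![a, b, c, d, e] (Equiv.swap 0 p k.succ)) =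
      ![![b, c, d, e], ![a, c, d, e], ![b, a, d, e], ![b, c, a, e], ![b, c, d, a]] p := by
    funext k
    fin_cases p <;> fin_cases k <;> rfl
  simp_rw [h]
  simp [Fin.sum_univ_succ, Fin.succ_ne_zero, -Fin.succ_zero_eq_one]
  ring

theorem signedSum_fin_six (F : (Fin 6 → κ) → ℝ) (a b c d e f : κ) :
    signedSum F ![a, b, c, d, e, f] =
      signedSum (fun w => F (Fin.cons a w)) ![b, c, d, e, f] -
      signedSum (fun w => F (Fin.cons b w)) ![a, c, d, e, f] -
      signedSum (fun w => F (Fin.cons c w)) ![b, a, d, e, f] -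
      signedSum (fun w => F (Fin.cons d w)) ![b, c, a, e, f] -
      signedSum (fun w => F (Fin.cons e w)) ![b, c, d, a, f] -
      signedSum (fun w => F (Fin.cons f w)) ![b, c, d, e, a] := by
  rw [signedSum_succ]
  have h (p : Fin 6) : (fun k : Fin 5 => ![a, b, c, d, e, f] (Equiv.swap 0 p k.succ)) =
      ![![b, c, d, e, f], ![a, c, d, e, f], ![b, a, d, e, f], ![b, c, a, e, f],
        ![b, c, d, a, f], ![b, c, d, e, a]] p := by
    funext k
    fin_cases p <;> fin_cases k <;> rfl
  simp_rw [h]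
  simp [Fin.sum_univ_succ, Fin.succ_ne_zero, -Fin.succ_zero_eq_one]
  ring

theorem signedSum_two_three (f : κ → κ → ℝ) (g : κ → κ → κ → ℝ) (hf : ∀ a b, f a b = -f b a)
    (hg : ∀ a b c, g a b c = -g b a c) (hg' : ∀ a b c, g a b c = -g a c b) (a b c d e : κ) :
    signedSum (fun w => f (w 0) (w 1) * g (w 2) (w 3) (w 4)) ![a, b, c, d, e] =
      12 * shuffleSum f g a b c d e := by
  have h3 (r : ℝ) (x y z : κ) :
      signedSum (fun w => r * g (w 0) (w 1) (w 2)) ![x, y, z] = 6 * (r * g x y z) := by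
    simp only [signedSum_fin_three, signedSum_fin_two, signedSum_fin_one]
    simp
    grind
  have h5 (x y : κ) (w : Fin 3 → κ) : (Fin.cons x (Fin.cons y w : Fin 4 → κ) : Fin 5 → κ) 2 = w 0 ∧
      (Fin.cons x (Fin.cons y w : Fin 4 → κ) : Fin 5 → κ) 3 = w 1 ∧
      (Fin.cons x (Fin.cons y w : Fin 4 → κ) : Fin 5 → κ) 4 = w 2 := ⟨rfl, rfl, rfl⟩
  simp only [signedSum_fin_five, signedSum_fin_four, h5, Fin.cons_zero, Fin.cons_one, h3,
    shuffleSum]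
  grind

end SignedSum

section HitchinMatrix

/-- The matrix of the Hitchin endomorphism of the `3`-form with coefficients `w`. -/
def hitchinMatrix (w : Fin 6 → Fin 6 → Fin 6 → ℝ) : Matrix (Fin 6) (Fin 6) ℝ :=
  Matrix.of ![fun j => shuffleSum (w j) w 1 2 3 4 5, fun j => -shuffleSum (w j) w 0 2 3 4 5,
    fun j => shuffleSum (w j) w 0 1 3 4 5, fun j => -shuffleSum (w j) w 0 1 2 4 5,
    fun j => shuffleSum (w j) w 0 1 2 3 5, fun j => -shuffleSum (w j) w 0 1 2 3 4]

variable {w : Fin 6 → Fin 6 → Fin 6 → ℝ}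

set_option maxHeartbeats 4000000 in
theorem hitchinMatrix_eq (h₁ : ∀ i j k, w i j k = -w j i k) (h₂ : ∀ i j k, w i j k = -w i k j) :
    hitchinMatrix w =
    !![w 0 1 2 * w 3 4 5 - w 0 1 3 * w 2 4 5 + w 0 1 4 * w 2 3 5 - w 0 1 5 * w 2 3 4 +
        w 0 2 3 * w 1 4 5 - w 0 2 4 * w 1 3 5 + w 0 2 5 * w 1 3 4 + w 0 3 4 * w 1 2 5 -
        w 0 3 5 * w 1 2 4 + w 0 4 5 * w 1 2 3,
      2 * w 1 2 3 * w 1 4 5 - 2 * w 1 2 4 * w 1 3 5 + 2 * w 1 2 5 * w 1 3 4,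
      2 * w 1 2 3 * w 2 4 5 - 2 * w 1 2 4 * w 2 3 5 + 2 * w 1 2 5 * w 2 3 4,
      2 * w 1 2 3 * w 3 4 5 - 2 * w 1 3 4 * w 2 3 5 + 2 * w 1 3 5 * w 2 3 4,
      2 * w 1 2 4 * w 3 4 5 - 2 * w 1 3 4 * w 2 4 5 + 2 * w 1 4 5 * w 2 3 4,
      2 * w 1 2 5 * w 3 4 5 - 2 * w 1 3 5 * w 2 4 5 + 2 * w 1 4 5 * w 2 3 5;
      -2 * w 0 2 3 * w 0 4 5 + 2 * w 0 2 4 * w 0 3 5 - 2 * w 0 2 5 * w 0 3 4,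
      w 0 1 2 * w 3 4 5 - w 0 1 3 * w 2 4 5 + w 0 1 4 * w 2 3 5 - w 0 1 5 * w 2 3 4 -
        w 0 2 3 * w 1 4 5 + w 0 2 4 * w 1 3 5 - w 0 2 5 * w 1 3 4 - w 0 3 4 * w 1 2 5 +
        w 0 3 5 * w 1 2 4 - w 0 4 5 * w 1 2 3,
      -2 * w 0 2 3 * w 2 4 5 + 2 * w 0 2 4 * w 2 3 5 - 2 * w 0 2 5 * w 2 3 4,
      -2 * w 0 2 3 * w 3 4 5 + 2 * w 0 3 4 * w 2 3 5 - 2 * w 0 3 5 * w 2 3 4,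
      -2 * w 0 2 4 * w 3 4 5 + 2 * w 0 3 4 * w 2 4 5 - 2 * w 0 4 5 * w 2 3 4,
      -2 * w 0 2 5 * w 3 4 5 + 2 * w 0 3 5 * w 2 4 5 - 2 * w 0 4 5 * w 2 3 5;
      2 * w 0 1 3 * w 0 4 5 - 2 * w 0 1 4 * w 0 3 5 + 2 * w 0 1 5 * w 0 3 4,
      2 * w 0 1 3 * w 1 4 5 - 2 * w 0 1 4 * w 1 3 5 + 2 * w 0 1 5 * w 1 3 4,
      w 0 1 2 * w 3 4 5 + w 0 1 3 * w 2 4 5 - w 0 1 4 * w 2 3 5 + w 0 1 5 * w 2 3 4 +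
        w 0 2 3 * w 1 4 5 - w 0 2 4 * w 1 3 5 + w 0 2 5 * w 1 3 4 - w 0 3 4 * w 1 2 5 +
        w 0 3 5 * w 1 2 4 - w 0 4 5 * w 1 2 3,
      2 * w 0 1 3 * w 3 4 5 - 2 * w 0 3 4 * w 1 3 5 + 2 * w 0 3 5 * w 1 3 4,
      2 * w 0 1 4 * w 3 4 5 - 2 * w 0 3 4 * w 1 4 5 + 2 * w 0 4 5 * w 1 3 4,
      2 * w 0 1 5 * w 3 4 5 - 2 * w 0 3 5 * w 1 4 5 + 2 * w 0 4 5 * w 1 3 5;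
      -2 * w 0 1 2 * w 0 4 5 + 2 * w 0 1 4 * w 0 2 5 - 2 * w 0 1 5 * w 0 2 4,
      -2 * w 0 1 2 * w 1 4 5 + 2 * w 0 1 4 * w 1 2 5 - 2 * w 0 1 5 * w 1 2 4,
      -2 * w 0 1 2 * w 2 4 5 + 2 * w 0 2 4 * w 1 2 5 - 2 * w 0 2 5 * w 1 2 4,
      -w 0 1 2 * w 3 4 5 - w 0 1 3 * w 2 4 5 - w 0 1 4 * w 2 3 5 + w 0 1 5 * w 2 3 4 +
        w 0 2 3 * w 1 4 5 + w 0 2 4 * w 1 3 5 - w 0 2 5 * w 1 3 4 + w 0 3 4 * w 1 2 5 -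
        w 0 3 5 * w 1 2 4 - w 0 4 5 * w 1 2 3,
      -2 * w 0 1 4 * w 2 4 5 + 2 * w 0 2 4 * w 1 4 5 - 2 * w 0 4 5 * w 1 2 4,
      -2 * w 0 1 5 * w 2 4 5 + 2 * w 0 2 5 * w 1 4 5 - 2 * w 0 4 5 * w 1 2 5;
      2 * w 0 1 2 * w 0 3 5 - 2 * w 0 1 3 * w 0 2 5 + 2 * w 0 1 5 * w 0 2 3,
      2 * w 0 1 2 * w 1 3 5 - 2 * w 0 1 3 * w 1 2 5 + 2 * w 0 1 5 * w 1 2 3,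
      2 * w 0 1 2 * w 2 3 5 - 2 * w 0 2 3 * w 1 2 5 + 2 * w 0 2 5 * w 1 2 3,
      2 * w 0 1 3 * w 2 3 5 - 2 * w 0 2 3 * w 1 3 5 + 2 * w 0 3 5 * w 1 2 3,
      -w 0 1 2 * w 3 4 5 + w 0 1 3 * w 2 4 5 + w 0 1 4 * w 2 3 5 + w 0 1 5 * w 2 3 4 -
        w 0 2 3 * w 1 4 5 - w 0 2 4 * w 1 3 5 - w 0 2 5 * w 1 3 4 + w 0 3 4 * w 1 2 5 +
        w 0 3 5 * w 1 2 4 + w 0 4 5 * w 1 2 3,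
      2 * w 0 1 5 * w 2 3 5 - 2 * w 0 2 5 * w 1 3 5 + 2 * w 0 3 5 * w 1 2 5;
      -2 * w 0 1 2 * w 0 3 4 + 2 * w 0 1 3 * w 0 2 4 - 2 * w 0 1 4 * w 0 2 3,
      -2 * w 0 1 2 * w 1 3 4 + 2 * w 0 1 3 * w 1 2 4 - 2 * w 0 1 4 * w 1 2 3,
      -2 * w 0 1 2 * w 2 3 4 + 2 * w 0 2 3 * w 1 2 4 - 2 * w 0 2 4 * w 1 2 3,
      -2 * w 0 1 3 * w 2 3 4 + 2 * w 0 2 3 * w 1 3 4 - 2 * w 0 3 4 * w 1 2 3,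
      -2 * w 0 1 4 * w 2 3 4 + 2 * w 0 2 4 * w 1 3 4 - 2 * w 0 3 4 * w 1 2 4,
      -w 0 1 2 * w 3 4 5 + w 0 1 3 * w 2 4 5 - w 0 1 4 * w 2 3 5 - w 0 1 5 * w 2 3 4 -
        w 0 2 3 * w 1 4 5 + w 0 2 4 * w 1 3 5 + w 0 2 5 * w 1 3 4 - w 0 3 4 * w 1 2 5 -
        w 0 3 5 * w 1 2 4 + w 0 4 5 * w 1 2 3] := by
  have r₁ (i j k) (_ : j < i) : w i j k = -w j i k := h₁ i j k
  have r₂ (i j k) (_ : k < j) : w i j k = -w i k j := h₂ i j k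
  have z₁ (i k) : w i i k = 0 := by linarith [h₁ i i k]
  have z₂ (i k) : w i k k = 0 := by linarith [h₂ i k k]
  ext i j
  fin_cases i <;> fin_cases j <;>
    simp only [hitchinMatrix, Matrix.of_apply, Matrix.cons_val, Fin.reduceFinMk, Fin.mk_one,
      Fin.zero_eta, Fin.isValue, shuffleSum, z₁, z₂, r₁, r₂, Fin.reduceLT] <;> ring

set_option maxHeartbeats 4000000 in
theorem sum_hitchinMatrix_symm (h₁ : ∀ i j k, w i j k = -w j i k)
    (h₂ : ∀ i j k, w i j k = -w i k j) (i j k : Fin 6) :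
    ∑ l, hitchinMatrix w l i * w l j k = ∑ l, hitchinMatrix w l j * w i l k := by
  have r₁ (i j k) (_ : j < i) : w i j k = -w j i k := h₁ i j k
  have r₂ (i j k) (_ : k < j) : w i j k = -w i k j := h₂ i j k
  have z₁ (i k) : w i i k = 0 := by linarith [h₁ i i k]
  have z₂ (i k) : w i k k = 0 := by linarith [h₂ i k k]
  wlog hij : i ≤ j generalizing i j
  · have := this j i (le_of_not_ge hij)
    simp only [h₁ _ i, h₁ j, mul_neg, Finset.sum_neg_distrib] at this ⊢
    linarith
  rw [hitchinMatrix_eq h₁ h₂]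
  simp only [Fin.sum_univ_six]
  fin_cases i <;> fin_cases j <;> first | exact absurd hij (by decide) | skip
  all_goals fin_cases k <;>
    simp only [Matrix.of_apply, Matrix.cons_val, Fin.reduceFinMk, Fin.mk_one, Fin.zero_eta,
      Fin.isValue, r₁, r₂, z₁, z₂, Fin.reduceLT] <;> ring

set_option maxHeartbeats 4000000 in
theorem hitchinMatrix_mul_self (h₁ : ∀ i j k, w i j k = -w j i k)
    (h₂ : ∀ i j k, w i j k = -w i k j) :
    hitchinMatrix w * hitchinMatrix w =
      ((1 / 6 : ℝ) * (hitchinMatrix w * hitchinMatrix w).trace) • 1 := by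
  have h : ∃ c : ℝ, ∀ i j, (hitchinMatrix w * hitchinMatrix w) i j = if i = j then c else 0 := by
    refine ⟨(hitchinMatrix w * hitchinMatrix w) 0 0, fun i j => ?_⟩
    rw [hitchinMatrix_eq h₁ h₂]
    simp only [Matrix.mul_apply, Fin.sum_univ_six]
    fin_cases i <;> fin_cases j <;>
      simp only [Matrix.of_apply, Matrix.cons_val, Fin.reduceFinMk, Fin.mk_one, Fin.zero_eta,
        Fin.isValue, Fin.reduceEq, if_true, if_false] <;> ring
  obtain ⟨c, hc⟩ := h
  have h : hitchinMatrix w * hitchinMatrix w = c • 1 := by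
    ext i j
    simp [hc, Matrix.one_apply]
  rw [h]
  simp only [Matrix.trace_smul, Matrix.trace_one, Fintype.card_fin, smul_eq_mul]
  congr 1
  push_cast
  ring

end HitchinMatrix

section HitchinEndomorphism

variable {V : Type*} [AddCommGroup V] [Module ℝ V]

theorem signedSum_const_mul {κ : Type*} {n : ℕ} (r : ℝ) (F : (Fin n → κ) → ℝ) (u : Fin n → κ) :
    signedSum (fun w => r * F w) u = r * signedSum F u := by
  simp only [signedSum, Finset.mul_sum]
  exact Finset.sum_congr rfl fun σ _ => by ring

/-- The coefficients of a `3`-form with respect to a family of vectors. -/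
def coeffs {n : ℕ} (ω : AlternatingMap ℝ V ℝ (Fin 3)) (v : Fin n → V) (i j k : Fin n) : ℝ :=
  ω ![v i, v j, v k]

theorem map_swap_zero_one {A : Type*} [AddCommGroup A] [Module ℝ A]
    (ω : AlternatingMap ℝ V A (Fin 3)) (x y z : V) : ω ![x, y, z] = -ω ![y, x, z] := by
  rw [← ω.map_swap ![y, x, z] (i := 0) (j := 1) (by decide)]
  congr 1
  ext i
  fin_cases i <;> rfl

theorem map_swap_one_two {A : Type*} [AddCommGroup A] [Module ℝ A]
    (ω : AlternatingMap ℝ V A (Fin 3)) (x y z : V) : ω ![x, y, z] = -ω ![x, z, y] := by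
  rw [← ω.map_swap ![x, z, y] (i := 1) (j := 2) (by decide)]
  congr 1
  ext i
  fin_cases i <;> rfl

theorem wedge_coord_curryLeft_apply (ω : AlternatingMap ℝ V ℝ (Fin 3))
    (b : Module.Basis (Fin 6) ℝ V) (i j : Fin 6) :
    wedge (oneForm (b.coord i)) (wedge (ω.curryLeft (b j)) ω) b =
      hitchinMatrix (coeffs ω b) i j := by
  have h := wedge_oneForm_wedge (b.coord i) (ω.curryLeft (b j)) ω b
  have h' : (∑ σ : Equiv.Perm (Fin (1 + (2 + 3))), Equiv.Perm.sign σ •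
        (b.coord i (b (σ (Fin.castAdd (2 + 3) 0))) *
          (ω.curryLeft (b j) (fun i => b (σ (Fin.natAdd 1 (Fin.castAdd 3 i)))) *
            ω (fun i => b (σ (Fin.natAdd 1 (Fin.natAdd 2 i))))))) =
      signedSum (fun w => b.coord i (b (w 0)) * (coeffs ω b j (w 1) (w 2) *
        coeffs ω b (w 3) (w 4) (w 5))) ![0, 1, 2, 3, 4, 5] := by
    refine Finset.sum_congr rfl fun σ _ => ?_
    have hid : (![0, 1, 2, 3, 4, 5] : Fin 6 → Fin 6) = id := by decide
    rw [Units.smul_def, zsmul_eq_mul, hid, Function.id_comp]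
    congr 3
    · simp only [coeffs, AlternatingMap.curryLeft_apply_apply]
      congr 1
      ext m
      fin_cases m <;> rfl
    · simp only [coeffs]
      congr 1
      ext m
      fin_cases m <;> rfl
  rw [h'] at h
  have hc (p : Fin 6) (w : Fin 5 → Fin 6) : (Fin.cons p w : Fin 6 → Fin 6) 2 = w 1 ∧
      (Fin.cons p w : Fin 6 → Fin 6) 3 = w 2 ∧ (Fin.cons p w : Fin 6 → Fin 6) 4 = w 3 ∧
      (Fin.cons p w : Fin 6 → Fin 6) 5 = w 4 := ⟨rfl, rfl, rfl, rfl⟩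
  have h₁ (i j k) : coeffs ω b i j k = -coeffs ω b j i k := map_swap_zero_one ω _ _ _
  have h₂ (i j k) : coeffs ω b i j k = -coeffs ω b i k j := map_swap_one_two ω _ _ _
  simp only [signedSum_fin_six, hc, Fin.cons_zero, Fin.cons_one, signedSum_const_mul,
    signedSum_two_three (coeffs ω b j) (coeffs ω b) (h₂ j) h₁ h₂] at h
  generalize coeffs ω b = w at *
  generalize hW : (wedge (oneForm (b.coord i)) (wedge (ω.curryLeft (b j)) ω)) b = W at *
  simp only [Nat.factorial] at h
  simp only [Module.Basis.coord_apply, Module.Basis.repr_self] at h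
  fin_cases i <;> simp [hitchinMatrix, shuffleSum] at h ⊢ <;> grind

variable {θ : AlternatingMap ℝ V ℝ (Fin 6)}
  {ω : AlternatingMap ℝ V ℝ (Fin 3)} {K : V →ₗ[ℝ] V}

theorem smul_toMatrix_eq_hitchinMatrix
    (hK : ∀ (ξ : Module.Dual ℝ V) (X : V),
      ξ (K X) • θ = wedge (oneForm ξ) (wedge (ω.curryLeft X) ω))
    (b : Module.Basis (Fin 6) ℝ V) :
    θ b • LinearMap.toMatrix b b K = hitchinMatrix (coeffs ω b) := by
  ext i j
  rw [← wedge_coord_curryLeft_apply, ← hK]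
  simp [LinearMap.toMatrix_apply, mul_comm]

theorem sq_mul_trace_comp_self
    (hK : ∀ (ξ : Module.Dual ℝ V) (X : V),
      ξ (K X) • θ = wedge (oneForm ξ) (wedge (ω.curryLeft X) ω))
    (b : Module.Basis (Fin 6) ℝ V) :
    θ b ^ 2 * LinearMap.trace ℝ V (K ∘ₗ K) =
      (hitchinMatrix (coeffs ω b) * hitchinMatrix (coeffs ω b)).trace := by
  rw [← smul_toMatrix_eq_hitchinMatrix hK b, LinearMap.trace_eq_matrix_trace ℝ b,
    LinearMap.toMatrix_comp b b b]
  simp [sq, mul_assoc]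

theorem comp_self_eq_smul_id (hθ : θ ≠ 0)
    (hK : ∀ (ξ : Module.Dual ℝ V) (X : V),
      ξ (K X) • θ = wedge (oneForm ξ) (wedge (ω.curryLeft X) ω))
    (b : Module.Basis (Fin 6) ℝ V) :
    K ∘ₗ K = ((1 / 6 : ℝ) * LinearMap.trace ℝ V (K ∘ₗ K)) • LinearMap.id := by
  have hb : θ b ≠ 0 := (AlternatingMap.map_basis_ne_zero_iff b θ).mpr hθ
  have h := hitchinMatrix_mul_self (w := coeffs ω b) (fun _ _ _ => map_swap_zero_one ω _ _ _)
    (fun _ _ _ => map_swap_one_two ω _ _ _)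
  rw [← sq_mul_trace_comp_self hK b, ← smul_toMatrix_eq_hitchinMatrix hK b, Matrix.smul_mul,
    Matrix.mul_smul, smul_smul, ← LinearMap.toMatrix_comp b b b] at h
  apply (LinearMap.toMatrix b b).injective
  rw [map_smul, LinearMap.toMatrix_id]
  refine smul_right_injective _ (mul_ne_zero hb hb) ?_
  simp only [h, smul_smul]
  congr 1
  ring

theorem map_hitchin_symm (hθ : θ ≠ 0)
    (hK : ∀ (ξ : Module.Dual ℝ V) (X : V),
      ξ (K X) • θ = wedge (oneForm ξ) (wedge (ω.curryLeft X) ω))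
    (b : Module.Basis (Fin 6) ℝ V) (x y z : V) : ω ![K x, y, z] = ω ![x, K y, z] := by
  have hb : θ b ≠ 0 := (AlternatingMap.map_basis_ne_zero_iff b θ).mpr hθ
  let L₀ (y z : V) : V →ₗ[ℝ] ℝ := ω.toMultilinearMap.toLinearMap ![0, y, z] 0
  let L₁ (x z : V) : V →ₗ[ℝ] ℝ := ω.toMultilinearMap.toLinearMap ![x, 0, z] 1
  let L₂ (x y : V) : V →ₗ[ℝ] ℝ := ω.toMultilinearMap.toLinearMap ![x, y, 0] 2
  have e₀ (x y z : V) : ω ![x, y, z] = L₀ y z x := by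
    simp only [L₀, MultilinearMap.toLinearMap_apply]
    exact congrArg ω (by ext i; fin_cases i <;> rfl)
  have e₁ (x y z : V) : ω ![x, y, z] = L₁ x z y := by
    simp only [L₁, MultilinearMap.toLinearMap_apply]
    exact congrArg ω (by ext i; fin_cases i <;> rfl)
  have e₂ (x y z : V) : ω ![x, y, z] = L₂ x y z := by
    simp only [L₂, MultilinearMap.toLinearMap_apply]
    exact congrArg ω (by ext i; fin_cases i <;> rfl)
  have hcoord (l i : Fin 6) :
      θ b * b.repr (K (b i)) l = hitchinMatrix (coeffs ω b) l i := by
    rw [← smul_toMatrix_eq_hitchinMatrix hK b]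
    simp [LinearMap.toMatrix_apply]
  have hbasis (i j k : Fin 6) : ω ![K (b i), b j, b k] = ω ![b i, K (b j), b k] := by
    apply mul_left_cancel₀ hb
    have h := sum_hitchinMatrix_symm (w := coeffs ω b) (fun _ _ _ => map_swap_zero_one ω _ _ _)
      (fun _ _ _ => map_swap_one_two ω _ _ _) i j k
    simp only [← hcoord, mul_assoc, ← Finset.mul_sum] at h
    rw [e₀, e₁, ← b.sum_repr (K (b i)), ← b.sum_repr (K (b j)), map_sum, map_sum]
    simp only [map_smul, smul_eq_mul]
    simp only [← e₀, ← e₁]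
    exact h
  have h₁ (j k : Fin 6) : L₀ (b j) (b k) ∘ₗ K = L₀ (K (b j)) (b k) :=
    b.ext fun i => by simpa only [LinearMap.comp_apply, ← e₀] using hbasis i j k
  have h₂ (k : Fin 6) : L₁ (K x) (b k) = L₁ x (b k) ∘ₗ K :=
    b.ext fun j => by
      simpa only [LinearMap.comp_apply, ← e₀, ← e₁] using LinearMap.congr_fun (h₁ j k) x
  have h₃ : L₂ (K x) y = L₂ x (K y) :=
    b.ext fun k => by
      simpa only [LinearMap.comp_apply, ← e₁, ← e₂] using LinearMap.congr_fun (h₂ k) y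
  simpa only [← e₂] using LinearMap.congr_fun h₃ z

end HitchinEndomorphism

section ComplexForms

variable {V : Type*} [AddCommGroup V] [Module ℝ V]

theorem detForm_wedge_conjAlt_detForm (ξ : Fin 3 → V →ₗ[ℝ] ℂ) (v : Fin 6 → V) :
    wedge (detForm ξ) (conjAlt (detForm ξ)) v =
      (Matrix.of fun i j : Fin 6 => ![ξ 0 (v i), ξ 1 (v i), ξ 2 (v i), star (ξ 0 (v i)),
        star (ξ 1 (v i)), star (ξ 2 (v i))] j).det := by
  rw [conjAlt_detForm, wedge_detForm, detForm_apply]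
  congr 1
  ext i j
  fin_cases j <;> rfl

theorem isDecomposableC3_detForm (ξ : Fin 3 → V →ₗ[ℝ] ℂ) : IsDecomposableC3 (detForm ξ) :=
  ⟨ξ 0, ξ 1, ξ 2, by rw [wedge_three_oneForms]; congr 1; ext i : 1; fin_cases i <;> rfl⟩

theorem eq_detForm_of_map_eq_I_mul (hdim : Module.finrank ℝ V = 6) [FiniteDimensional ℝ V]
    {α : AlternatingMap ℝ V ℂ (Fin 3)} (hα : α ≠ 0) (J : V →ₗ[ℝ] V)
    (hJ : ∀ x y z, α ![J x, y, z] = Complex.I * α ![x, y, z]) :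
    ∃ ξ : Fin 3 → V →ₗ[ℝ] ℂ, α = detForm ξ ∧ ∃ (c : Fin 3 → ℂ) (u : Fin 3 → V),
      (∀ k, c k ≠ 0) ∧ ∀ k m, ξ k (u m) = (if k = m then c k else 0) ∧
        ξ k (J (u m)) = if k = m then Complex.I * c k else 0 := by
  obtain ⟨u, hu⟩ : ∃ u, α u ≠ 0 := by
    by_contra! h
    exact hα (AlternatingMap.ext h)
  have hJ' (v : Fin 3 → V) (k : Fin 3) (x : V) :
      α (Function.update v k (J x)) = Complex.I * α (Function.update v k x) := by
    have h (x) : Function.update v 0 x = ![x, v 1, v 2] ∧ Function.update v 1 x = ![v 0, x, v 2] ∧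
        Function.update v 2 x = ![v 0, v 1, x] := by
      refine ⟨?_, ?_, ?_⟩ <;> ext i <;> fin_cases i <;> rfl
    fin_cases k
    · simp [h, hJ]
    · change α (Function.update v 1 (J x)) = Complex.I * α (Function.update v 1 x)
      rw [(h _).2.1, (h _).2.1, map_swap_zero_one α (v 0), map_swap_zero_one α (v 0), hJ, mul_neg]
    · change α (Function.update v 2 (J x)) = Complex.I * α (Function.update v 2 x)
      rw [(h _).2.2, (h _).2.2, map_swap_one_two α (v 0) (v 1), map_swap_one_two α (v 0) (v 1),
        map_swap_zero_one α (v 0), map_swap_zero_one α (v 0), hJ, mul_neg, mul_neg]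
  let ξ (k : Fin 3) : V →ₗ[ℝ] ℂ := (α u)⁻¹ • α.toMultilinearMap.toLinearMap u k
  have hξ (k : Fin 3) (x : V) : ξ k x = (α u)⁻¹ * α (Function.update u k x) := rfl
  have hξu (k m : Fin 3) : ξ k (u m) = if k = m then 1 else 0 := by
    rw [hξ]
    split_ifs with h
    · rw [← h, Function.update_eq_self, inv_mul_cancel₀ hu]
    · rw [α.map_update_self u h, mul_zero]
  have hξJ (k m : Fin 3) : ξ k (J (u m)) = if k = m then Complex.I else 0 := by
    rw [hξ, hJ', mul_left_comm, ← hξ, hξu]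
    simp
  let lift (a : Fin 3 → ℂ) : V := ∑ k, ((a k).re • u k + (a k).im • J (u k))
  let Φ : V →ₗ[ℝ] (Fin 3 → ℂ) := LinearMap.pi ξ
  have hlift (a : Fin 3 → ℂ) : Φ (lift a) = a := by
    ext k
    simp [Φ, lift, hξu, hξJ, Complex.re_add_im, Finset.sum_add_distrib]
  have hinj : Function.Injective Φ :=
    (LinearMap.injective_iff_surjective_of_finrank_eq_finrank
      (by rw [hdim, Module.finrank_pi_fintype]; simp [Complex.finrank_real_complex])).mpr
      fun a => ⟨lift a, hlift a⟩
  have hx (x : V) : x = ∑ k, ((ξ k x).re • u k + (ξ k x).im • J (u k)) :=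
    hinj (hlift (Φ x)).symm
  have hexp (v : Fin 3 → V) (i : Fin 3) :
      α v = ∑ k, ξ k (v i) * α (Function.update v i (u k)) := by
    conv_lhs => rw [← Function.update_eq_self i v, hx (v i), AlternatingMap.map_update_sum]
    refine Finset.sum_congr rfl fun k _ => ?_
    rw [AlternatingMap.map_update_add, AlternatingMap.map_update_smul,
      AlternatingMap.map_update_smul, hJ', Complex.real_smul, Complex.real_smul]
    conv_rhs => rw [← Complex.re_add_im (ξ k (v i))]
    ring
  have hdet : α = detForm ![α u • ξ 0, ξ 1, ξ 2] := by
    ext v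
    have hupd (k l m : Fin 3) :
        Function.update (Function.update (Function.update v 0 (u k)) 1 (u l)) 2 (u m) =
          ![u k, u l, u m] := by
      ext i; fin_cases i <;> rfl
    have hu3 : u = ![u 0, u 1, u 2] := by
      ext i; fin_cases i <;> rfl
    have z₁ (x y : V) : α ![x, x, y] = 0 := α.map_eq_zero_of_eq _ (i := 0) (j := 1) rfl (by decide)
    have z₂ (x y : V) : α ![x, y, y] = 0 := α.map_eq_zero_of_eq _ (i := 1) (j := 2) rfl (by decide)
    have z₃ (x y : V) : α ![x, y, x] = 0 := α.map_eq_zero_of_eq _ (i := 0) (j := 2) rfl (by decide)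
    rw [hexp v 0]
    simp_rw [hexp (Function.update v 0 _) 1, hexp (Function.update (Function.update v 0 _) 1 _) 2,
      hupd]
    generalize hc : α u = c
    rw [hu3] at hc
    have h102 : α ![u 1, u 0, u 2] = -c := by rw [map_swap_zero_one, hc]
    have h021 : α ![u 0, u 2, u 1] = -c := by rw [map_swap_one_two, hc]
    have h120 : α ![u 1, u 2, u 0] = c := by rw [map_swap_one_two, h102, neg_neg]
    have h201 : α ![u 2, u 0, u 1] = c := by rw [map_swap_zero_one, h021, neg_neg]
    have h210 : α ![u 2, u 1, u 0] = -c := by rw [map_swap_one_two, h201]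
    simp [Fin.sum_univ_three, detForm_apply, Matrix.det_fin_three, z₁, z₂, z₃, hc, h102, h021,
      h120, h201, h210]
    ring
  refine ⟨_, hdet, ![α u, 1, 1], u, fun k => by fin_cases k <;> simp [hu], fun k m => ?_⟩
  constructor <;> fin_cases k <;> simp [hξu, hξJ, mul_comm]

theorem wedge_conjAlt_ne_zero {ξ : Fin 3 → V →ₗ[ℝ] ℂ} {J : V → V} {c : Fin 3 → ℂ} {u : Fin 3 → V}
    (hc : ∀ k, c k ≠ 0) (hξ : ∀ k m, ξ k (u m) = (if k = m then c k else 0) ∧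
      ξ k (J (u m)) = if k = m then Complex.I * c k else 0) :
    wedge (detForm ξ) (conjAlt (detForm ξ)) ≠ 0 := by
  intro h
  have h := DFunLike.congr_fun h ![u 0, u 1, u 2, J (u 0), J (u 1), J (u 2)]
  rw [detForm_wedge_conjAlt_detForm, AlternatingMap.zero_apply,
    ← Matrix.exists_mulVec_eq_zero_iff] at h
  obtain ⟨a, ha, h⟩ := h
  apply ha
  have e (i : Fin 6) := congrFun h i
  simp only [Matrix.mulVec, dotProduct, Fin.sum_univ_six] at e
  have key (p : ℂ) (hp : p ≠ 0) (x y : ℂ) (h₁ : p * x + star p * y = 0)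
      (h₂ : Complex.I * p * x + star (Complex.I * p) * y = 0) : x = 0 ∧ y = 0 := by
    have hs : star p ≠ 0 := star_ne_zero.mpr hp
    have h₃ : p * x - star p * y = 0 := by
      apply mul_left_cancel₀ Complex.I_ne_zero
      rw [star_mul', Complex.star_def, Complex.conj_I] at h₂
      rw [Complex.star_def]
      linear_combination h₂
    constructor
    · exact (mul_eq_zero.mp (by linear_combination (h₁ + h₃) / 2 : p * x = 0)).resolve_left hp
    · exact (mul_eq_zero.mp (by linear_combination (h₁ - h₃) / 2 : star p * y = 0)).resolve_left hs
  have k₀ := key (c 0) (hc 0) (a 0) (a 3) (by simpa [hξ] using e 0) (by simpa [hξ] using e 3)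
  have k₁ := key (c 1) (hc 1) (a 1) (a 4) (by simpa [hξ] using e 1) (by simpa [hξ] using e 4)
  have k₂ := key (c 2) (hc 2) (a 2) (a 5) (by simpa [hξ] using e 2) (by simpa [hξ] using e 5)
  ext i
  fin_cases i
  exacts [k₀.1, k₁.1, k₂.1, k₀.2, k₁.2, k₂.2]

theorem exists_basis_of_wedge_conjAlt_ne_zero (hdim : Module.finrank ℝ V = 6)
    [FiniteDimensional ℝ V] {ξ : Fin 3 → V →ₗ[ℝ] ℂ}
    (h : wedge (detForm ξ) (conjAlt (detForm ξ)) ≠ 0) :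
    ∃ b : Module.Basis (Fin 6) ℝ V, ∀ k i, ξ k (b i) =
      !![1, 0, 0, Complex.I, 0, 0; 0, 1, 0, 0, Complex.I, 0; 0, 0, 1, 0, 0, Complex.I] k i := by
  obtain ⟨v, hv⟩ : ∃ v : Fin 6 → V, wedge (detForm ξ) (conjAlt (detForm ξ)) v ≠ 0 := by
    by_contra! h'
    exact h (AlternatingMap.ext h')
  have hli : LinearIndependent ℝ v := by
    by_contra h'
    exact hv (AlternatingMap.map_linearDependent _ v h')
  rw [detForm_wedge_conjAlt_detForm] at hv
  let B := basisOfLinearIndependentOfCardEqFinrank hli (by simp [hdim])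
  let Φ : V →ₗ[ℝ] (Fin 6 → ℝ) := LinearMap.pi
    ![Complex.reLm ∘ₗ ξ 0, Complex.reLm ∘ₗ ξ 1, Complex.reLm ∘ₗ ξ 2,
      Complex.imLm ∘ₗ ξ 0, Complex.imLm ∘ₗ ξ 1, Complex.imLm ∘ₗ ξ 2]
  have hΦ (x : V) : Φ x = ![(ξ 0 x).re, (ξ 1 x).re, (ξ 2 x).re, (ξ 0 x).im, (ξ 1 x).im,
      (ξ 2 x).im] := by
    ext i; fin_cases i <;> rfl
  have hinj : Function.Injective Φ := by
    rw [← LinearMap.ker_eq_bot, LinearMap.ker_eq_bot']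
    intro x hx
    rw [hΦ] at hx
    have hξx (k : Fin 3) : ξ k x = 0 := by
      fin_cases k
      · exact Complex.ext (congrFun hx 0) (congrFun hx 3)
      · exact Complex.ext (congrFun hx 1) (congrFun hx 4)
      · exact Complex.ext (congrFun hx 2) (congrFun hx 5)
    have hsum (k : Fin 3) : ∑ i, (B.repr x i : ℂ) * ξ k (v i) = 0 := by
      rw [← hξx k]
      conv_rhs => rw [← B.sum_repr x]
      simp [B]
    have hsum' (k : Fin 3) : ∑ i, (B.repr x i : ℂ) * star (ξ k (v i)) = 0 := by
      have := congrArg star (hsum k)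
      simpa using this
    have h0 := Matrix.eq_zero_of_vecMul_eq_zero hv (v := fun i => (B.repr x i : ℂ)) (by
      ext j
      simp only [Matrix.vecMul, dotProduct, Matrix.of_apply]
      fin_cases j
      exacts [hsum 0, hsum 1, hsum 2, hsum' 0, hsum' 1, hsum' 2])
    rw [← B.repr.map_eq_zero_iff]
    ext i
    simpa using congrFun h0 i
  let e : V ≃ₗ[ℝ] (Fin 6 → ℝ) := LinearMap.linearEquivOfInjective Φ hinj (by simp [hdim])
  refine ⟨Module.Basis.ofEquivFun e, fun k i => ?_⟩
  have hb : Φ (Module.Basis.ofEquivFun e i) = Pi.single i 1 := by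
    change e _ = _
    simp
  rw [hΦ] at hb
  have h (j) := congrFun hb j
  apply Complex.ext
  · fin_cases k
    · refine (h 0).trans ?_
      fin_cases i <;> simp
    · refine (h 1).trans ?_
      fin_cases i <;> simp
    · refine (h 2).trans ?_
      fin_cases i <;> simp
  · fin_cases k
    · refine (h 3).trans ?_
      fin_cases i <;> simp
    · refine (h 4).trans ?_
      fin_cases i <;> simp
    · refine (h 5).trans ?_
      fin_cases i <;> simp

theorem trace_hitchinMatrix_neg {ω : AlternatingMap ℝ V ℝ (Fin 3)} {ξ : Fin 3 → V →ₗ[ℝ] ℂ}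
    (hω : complexify ω = detForm ξ + conjAlt (detForm ξ)) (b : Fin 6 → V)
    (hb : ∀ k i, ξ k (b i) =
      !![1, 0, 0, Complex.I, 0, 0; 0, 1, 0, 0, Complex.I, 0; 0, 0, 1, 0, 0, Complex.I] k i) :
    (hitchinMatrix (coeffs ω b) * hitchinMatrix (coeffs ω b)).trace < 0 := by
  have hw (i j k : Fin 6) : coeffs ω b i j k = 2 * (detForm ξ ![b i, b j, b k]).re := by
    have h := congrArg Complex.re (DFunLike.congr_fun hω ![b i, b j, b k])
    have h' : (complexify ω ![b i, b j, b k]).re = coeffs ω b i j k := rfl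
    have h'' : (conjAlt (detForm ξ) ![b i, b j, b k]).re = (detForm ξ ![b i, b j, b k]).re := rfl
    rw [h', AlternatingMap.add_apply, Complex.add_re, h''] at h
    rw [h]; ring
  simp only [detForm_apply, Matrix.det_fin_three, Matrix.of_apply, Matrix.cons_val, hb] at hw
  rw [hitchinMatrix_eq (w := coeffs ω b) (fun _ _ _ => map_swap_zero_one ω _ _ _)
    (fun _ _ _ => map_swap_one_two ω _ _ _)]
  simp only [hw, Matrix.trace, Matrix.diag, Matrix.mul_apply, Fin.sum_univ_six, Matrix.of_apply,
    Matrix.cons_val]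
  norm_num

end ComplexForms

theorem hitchinAlphaNeg_apply {V : Type*} [AddCommGroup V] [Module ℝ V]
    (ω : AlternatingMap ℝ V ℝ (Fin 3)) (K : V →ₗ[ℝ] V) (lam : ℝ) (v : Fin 3 → V) :
    hitchinAlphaNeg ω K lam v =
      2⁻¹ * (ω v + (|lam| ^ (-(3 / 2) : ℝ) : ℝ) * (Complex.I * ω fun i => K (v i))) := by
  simp only [hitchinAlphaNeg, AlternatingMap.smul_apply, AlternatingMap.add_apply,
    Complex.real_smul, smul_eq_mul, Complex.ofReal_inv, Complex.ofReal_ofNat]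
  rfl

theorem complexify_eq_hitchinAlphaNeg_add_conjAlt {V : Type*} [AddCommGroup V] [Module ℝ V]
    (ω : AlternatingMap ℝ V ℝ (Fin 3)) (K : V →ₗ[ℝ] V) (lam : ℝ) :
    complexify ω = hitchinAlphaNeg ω K lam + conjAlt (hitchinAlphaNeg ω K lam) := by
  ext v
  rw [AlternatingMap.add_apply]
  change (ω v : ℂ) = _ + (starRingEnd ℂ) (hitchinAlphaNeg ω K lam v)
  rw [hitchinAlphaNeg_apply]
  simp only [map_mul, map_add, map_inv₀, Complex.conj_ofReal, Complex.conj_I, map_ofNat]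
  ring

theorem isDecomposableC3_hitchinAlphaNeg {V : Type*} [AddCommGroup V] [Module ℝ V]
    [FiniteDimensional ℝ V] (hdim : Module.finrank ℝ V = 6)
    {θ : AlternatingMap ℝ V ℝ (Fin 6)} (hθ : θ ≠ 0)
    {ω : AlternatingMap ℝ V ℝ (Fin 3)} {K : V →ₗ[ℝ] V}
    (hK : ∀ (ξ : Module.Dual ℝ V) (X : V),
      ξ (K X) • θ = wedge (oneForm ξ) (wedge (ω.curryLeft X) ω))
    {lam : ℝ} (hlam : lam = (1 / 6 : ℝ) * LinearMap.trace ℝ V (K ∘ₗ K)) (hneg : lam < 0) :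
    IsDecomposableC3 (hitchinAlphaNeg ω K lam) ∧
      wedge (hitchinAlphaNeg ω K lam) (conjAlt (hitchinAlphaNeg ω K lam)) ≠ 0 := by
  let b := Module.finBasisOfFinrankEq ℝ V hdim
  have hKK (x : V) : K (K x) = lam • x := by
    have h := LinearMap.congr_fun (comp_self_eq_smul_id hθ hK b) x
    rwa [← hlam] at h
  have hsymm := map_hitchin_symm hθ hK b
  have hsmul (c : ℝ) (x y z : V) : ω ![c • x, y, z] = c * ω ![x, y, z] :=
    AlternatingMap.map_vecCons_smul ω ![y, z] c x
  have hpull (x y z : V) : ω ![K x, K y, K z] = lam * ω ![K x, y, z] := by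
    rw [← hsymm, hKK, map_swap_one_two, hsmul, ← hsymm, map_swap_one_two ω (K x) z, mul_neg,
      neg_neg]
  set α := hitchinAlphaNeg ω K lam with hα
  have hadd : complexify ω = α + conjAlt α := complexify_eq_hitchinAlphaNeg_add_conjAlt ω K lam
  have hα₀ : α ≠ 0 := by
    intro h
    have hω (v : Fin 3 → V) : ω v = 0 := by
      have := DFunLike.congr_fun hadd v
      rw [h] at this
      have hre := congrArg Complex.re this
      exact hre.trans (by simp [conjAlt])
    have hcoeffs : coeffs ω b = 0 := by
      ext i j k
      exact hω _
    have hθb : θ b ≠ 0 := (AlternatingMap.map_basis_ne_zero_iff b θ).mpr hθ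
    have hw : hitchinMatrix (coeffs ω b) = 0 := by
      rw [hcoeffs, hitchinMatrix_eq (fun _ _ _ => by simp) fun _ _ _ => by simp]
      ext i j
      fin_cases i <;> fin_cases j <;> simp
    have htr := sq_mul_trace_comp_self hK b
    rw [hw, Matrix.mul_zero, Matrix.trace_zero] at htr
    have := (mul_eq_zero.mp htr).resolve_left (pow_ne_zero 2 hθb)
    rw [this, mul_zero] at hlam
    exact hneg.ne hlam
  set r : ℝ := |lam| ^ (-(3 / 2) : ℝ) with hr
  have hr₂ : r ^ 2 * lam ^ 3 = -1 := by
    have habs : 0 < |lam| := abs_pos.mpr hneg.ne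
    have h : r ^ 2 * |lam| ^ 3 = 1 := by
      rw [hr, ← Real.rpow_natCast, ← Real.rpow_natCast, ← Real.rpow_mul habs.le,
        ← Real.rpow_add habs]
      norm_num
    rw [abs_of_neg hneg] at h
    linear_combination -h
  have hα_apply (x y z : V) : α ![x, y, z] =
      2⁻¹ * (ω ![x, y, z] + Complex.I * ((r * lam : ℝ) * ω ![K x, y, z])) := by
    have h : (fun i => K (![x, y, z] i)) = ![K x, K y, K z] := by
      ext i; fin_cases i <;> rfl
    rw [hα, hitchinAlphaNeg_apply, h, hpull]
    push_cast
    ring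
  obtain ⟨ξ, hξ, c, u, hc, hξu⟩ := eq_detForm_of_map_eq_I_mul hdim hα₀ ((-(r * lam)) • K)
    fun x y z => by
      have hr₂' : (r : ℂ) ^ 2 * (lam : ℂ) ^ 3 = -1 := by exact_mod_cast hr₂
      rw [hα_apply, hα_apply, LinearMap.smul_apply, map_smul, hKK, hsmul, hsmul, hsmul]
      push_cast
      linear_combination (-Complex.I / 2 * ω ![x, y, z]) * hr₂' -
        (r * lam * ω ![K x, y, z] / 2 : ℂ) * Complex.I_sq
  rw [hξ]
  exact ⟨isDecomposableC3_detForm ξ, wedge_conjAlt_ne_zero hc hξu⟩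

/-- Hitchin: `λ(ω) < 0` iff `ω = α + conj(α)` for some decomposable complex 3-form `α`
with `α ∧ conj(α) ≠ 0`; in that case one may take
`α = (1/2)(ω + i·|λ(ω)|^{-3/2}·K_ω^*(ω))`, which is decomposable over `ℂ`. -/
theorem hitchin_negative_pfaffian_decomposition
    {V : Type*} [AddCommGroup V] [Module ℝ V] [FiniteDimensional ℝ V]
    (hdim : Module.finrank ℝ V = 6)
    (θ : AlternatingMap ℝ V ℝ (Fin 6)) (hθ : θ ≠ 0)
    (ω : AlternatingMap ℝ V ℝ (Fin 3))
    (K : V →ₗ[ℝ] V)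
    (hK : ∀ (ξ : Module.Dual ℝ V) (X : V),
      ξ (K X) • θ = wedge (oneForm ξ) (wedge (ω.curryLeft X) ω))
    (lam : ℝ) (hlam : lam = (1 / 6 : ℝ) * LinearMap.trace ℝ V (K ∘ₗ K)) :
    (lam < 0 ↔ ∃ α : AlternatingMap ℝ V ℂ (Fin 3),
        IsDecomposableC3 α ∧ wedge α (conjAlt α) ≠ 0 ∧
        complexify ω = α + conjAlt α) ∧
    (lam < 0 →
      IsDecomposableC3 (hitchinAlphaNeg ω K lam) ∧
      wedge (hitchinAlphaNeg ω K lam) (conjAlt (hitchinAlphaNeg ω K lam)) ≠ 0 ∧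
      complexify ω = hitchinAlphaNeg ω K lam + conjAlt (hitchinAlphaNeg ω K lam)) := by
  have hforward := isDecomposableC3_hitchinAlphaNeg hdim hθ hK hlam
  have hadd := complexify_eq_hitchinAlphaNeg_add_conjAlt ω K lam
  refine ⟨⟨fun h => ⟨_, (hforward h).1, (hforward h).2, hadd⟩, ?_⟩,
    fun h => ⟨(hforward h).1, (hforward h).2, hadd⟩⟩
  rintro ⟨α, ⟨ξ₁, ξ₂, ξ₃, rfl⟩, hne, hω⟩
  rw [wedge_three_oneForms] at hne hω
  obtain ⟨b, hb⟩ := exists_basis_of_wedge_conjAlt_ne_zero hdim hne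
  have hθb : θ b ≠ 0 := (AlternatingMap.map_basis_ne_zero_iff b θ).mpr hθ
  have hneg := trace_hitchinMatrix_neg hω b hb
  rw [← sq_mul_trace_comp_self hK b] at hneg
  have := neg_of_mul_neg_right hneg (sq_nonneg _)
  rw [hlam]
  linarith
end

section
/- The space of effective 3-forms on (V, Ω) is a linear subspace of Λ³V* of dimension 14, and the skew-symmetric pairing Θ on it, defined by ω∧ω′ = Θ(ω,ω′)·θ, is nondegenerate; i.e. the effective 3-forms form a 14-dimensional symplectic subspace of (Λ³V*, Θ). -/
open scoped TensorProduct

open Module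

open Equiv in
theorem wedge_apply_eq_sum {V : Type*} [AddCommGroup V] [Module ℝ V] {k l : ℕ}
    (α : AlternatingMap ℝ V ℝ (Fin k)) (β : AlternatingMap ℝ V ℝ (Fin l))
    {ι : Type*} [Fintype ι] (s : ι → Perm (Fin (k + l)))
    (hcard : Fintype.card ι = (k + l).choose k)
    (hs : ∀ i j, (∀ x : Fin k, ∃ y : Fin k, s j (Fin.castAdd l y) = s i (Fin.castAdd l x)) → i = j)
    (v : Fin (k + l) → V) :
    wedge α β v = ∑ i, ((Perm.sign (s i) : ℤ) : ℝ) *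
      (α (fun x ↦ v (s i (Fin.castAdd l x))) * β (fun x ↦ v (s i (Fin.natAdd k x)))) := by
  classical
  let t : ι → Perm (Fin k ⊕ Fin l) := fun i ↦ finSumFinEquiv.symm.permCongr (s i)
  let f : ι → Perm.ModSumCongr (Fin k) (Fin l) := fun i ↦ Quotient.mk'' (t i)
  have hf : Function.Injective f := by
    intro i j hij
    obtain ⟨⟨sl, sr⟩, h⟩ := QuotientGroup.leftRel_apply.mp (Quotient.exact' hij.symm)
    refine hs i j fun x ↦ ⟨sl x, ?_⟩
    have h' := Equiv.congr_fun (eq_inv_mul_iff_mul_eq.mp h) (Sum.inl x)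
    simpa [t, Equiv.permCongr_apply] using congrArg finSumFinEquiv h'
  have hcard' : Fintype.card ι = Fintype.card (Perm.ModSumCongr (Fin k) (Fin l)) := by
    have h := Subgroup.card_eq_card_quotient_mul_card_subgroup
      (Perm.sumCongrHom (Fin k) (Fin l)).range
    have h2 : Nat.card (Perm.sumCongrHom (Fin k) (Fin l)).range = k.factorial * l.factorial := by
      rw [Nat.card_congr (MonoidHom.ofInjective Perm.sumCongrHom_injective).toEquiv.symm]
      simp [Nat.card_eq_fintype_card, Fintype.card_perm]
    rw [h2, Nat.card_eq_fintype_card, Nat.card_eq_fintype_card, Fintype.card_perm,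
      Fintype.card_sum, Fintype.card_fin, Fintype.card_fin] at h
    have h3 := Nat.choose_mul_factorial_mul_factorial (Nat.le_add_right k l)
    rw [Nat.add_sub_cancel_left] at h3
    rw [hcard]
    apply Nat.eq_of_mul_eq_mul_right (Nat.mul_pos k.factorial_pos l.factorial_pos)
    rw [← h, ← h3, mul_assoc]
  have hbij : Function.Bijective f := (Fintype.bijective_iff_injective_and_card f).2 ⟨hf, hcard'⟩
  rw [wedge, LinearMap.compAlternatingMap_apply, AlternatingMap.domDomCongr_apply,
    AlternatingMap.domCoprod_apply, _root_.sum_apply, map_sum, ← hbij.sum_comp]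
  refine Finset.sum_congr rfl fun i _ ↦ ?_
  have hsign : Perm.sign (t i) = Perm.sign (s i) := by simp [t]
  simp only [f, AlternatingMap.domCoprod.summand_mk'', hsign]
  rw [_root_.smul_apply, MultilinearMap.domDomCongr_apply, MultilinearMap.domCoprod_apply]
  rcases Int.units_eq_one_or (Perm.sign (s i)) with h | h <;>
    simp [t, Equiv.permCongr_apply, h]

/-- The (3, 2)-shuffles. -/
def shuffleThreeTwo (i : Fin 10) : Equiv.Perm (Fin 5) where
  toFun := (![
      ![0, 1, 2, 3, 4],
      ![0, 1, 3, 2, 4],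
      ![0, 1, 4, 2, 3],
      ![0, 2, 3, 1, 4],
      ![0, 2, 4, 1, 3],
      ![0, 3, 4, 1, 2],
      ![1, 2, 3, 0, 4],
      ![1, 2, 4, 0, 3],
      ![1, 3, 4, 0, 2],
      ![2, 3, 4, 0, 1]] : Fin 10 → Fin 5 → Fin 5) i
  invFun := (![
      ![0, 1, 2, 3, 4],
      ![0, 1, 3, 2, 4],
      ![0, 1, 3, 4, 2],
      ![0, 3, 1, 2, 4],
      ![0, 3, 1, 4, 2],
      ![0, 3, 4, 1, 2],
      ![3, 0, 1, 2, 4],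
      ![3, 0, 1, 4, 2],
      ![3, 0, 4, 1, 2],
      ![3, 4, 0, 1, 2]] : Fin 10 → Fin 5 → Fin 5) i
  left_inv := by revert i; decide
  right_inv := by revert i; decide

theorem sign_shuffleThreeTwo (i : Fin 10) :
    Equiv.Perm.sign (shuffleThreeTwo i) =
      (![1, -1, 1, 1, -1, 1, -1, 1, -1, 1] : Fin 10 → ℤˣ) i := by
  revert i; decide

/-- The (3, 3)-shuffles. -/
def shuffleThreeThree (i : Fin 20) : Equiv.Perm (Fin 6) where
  toFun := (![
      ![0, 1, 2, 3, 4, 5],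
      ![0, 1, 3, 2, 4, 5],
      ![0, 1, 4, 2, 3, 5],
      ![0, 1, 5, 2, 3, 4],
      ![0, 2, 3, 1, 4, 5],
      ![0, 2, 4, 1, 3, 5],
      ![0, 2, 5, 1, 3, 4],
      ![0, 3, 4, 1, 2, 5],
      ![0, 3, 5, 1, 2, 4],
      ![0, 4, 5, 1, 2, 3],
      ![1, 2, 3, 0, 4, 5],
      ![1, 2, 4, 0, 3, 5],
      ![1, 2, 5, 0, 3, 4],
      ![1, 3, 4, 0, 2, 5],
      ![1, 3, 5, 0, 2, 4],
      ![1, 4, 5, 0, 2, 3],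
      ![2, 3, 4, 0, 1, 5],
      ![2, 3, 5, 0, 1, 4],
      ![2, 4, 5, 0, 1, 3],
      ![3, 4, 5, 0, 1, 2]] : Fin 20 → Fin 6 → Fin 6) i
  invFun := (![
      ![0, 1, 2, 3, 4, 5],
      ![0, 1, 3, 2, 4, 5],
      ![0, 1, 3, 4, 2, 5],
      ![0, 1, 3, 4, 5, 2],
      ![0, 3, 1, 2, 4, 5],
      ![0, 3, 1, 4, 2, 5],
      ![0, 3, 1, 4, 5, 2],
      ![0, 3, 4, 1, 2, 5],
      ![0, 3, 4, 1, 5, 2],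
      ![0, 3, 4, 5, 1, 2],
      ![3, 0, 1, 2, 4, 5],
      ![3, 0, 1, 4, 2, 5],
      ![3, 0, 1, 4, 5, 2],
      ![3, 0, 4, 1, 2, 5],
      ![3, 0, 4, 1, 5, 2],
      ![3, 0, 4, 5, 1, 2],
      ![3, 4, 0, 1, 2, 5],
      ![3, 4, 0, 1, 5, 2],
      ![3, 4, 0, 5, 1, 2],
      ![3, 4, 5, 0, 1, 2]] : Fin 20 → Fin 6 → Fin 6) i
  left_inv := by revert i; decide
  right_inv := by revert i; decide

theorem sign_shuffleThreeThree (i : Fin 20) :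
    Equiv.Perm.sign (shuffleThreeThree i) =
      (![1, -1, 1, -1, 1, -1, 1, 1, -1, 1, -1, 1, -1, -1, 1, -1, 1, -1, 1,
      -1] : Fin 20 → ℤˣ) i := by
  revert i; decide

theorem wedge_three_two_apply {V : Type*} [AddCommGroup V] [Module ℝ V]
    (α : AlternatingMap ℝ V ℝ (Fin 3)) (β : AlternatingMap ℝ V ℝ (Fin 2))
    (a b c d e : V) :
    wedge α β ![a, b, c, d, e] =
      α ![a, b, c] * β ![d, e] - α ![a, b, d] * β ![c, e] + α ![a, b, e] * β ![c, d]
      + α ![a, c, d] * β ![b, e] - α ![a, c, e] * β ![b, d] + α ![a, d, e] * β ![b, c]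
      - α ![b, c, d] * β ![a, e] + α ![b, c, e] * β ![a, d] - α ![b, d, e] * β ![a, c]
      + α ![c, d, e] * β ![a, b] := by
  rw [wedge_apply_eq_sum α β shuffleThreeTwo (by decide) (by decide)]
  have hα (i : Fin 10) : (fun x ↦ ![a, b, c, d, e] (shuffleThreeTwo i (Fin.castAdd 2 x))) =
      ![![a, b, c, d, e] (shuffleThreeTwo i 0), ![a, b, c, d, e] (shuffleThreeTwo i 1),
        ![a, b, c, d, e] (shuffleThreeTwo i 2)] := by
    ext x; fin_cases x <;> rfl
  have hβ (i : Fin 10) : (fun x ↦ ![a, b, c, d, e] (shuffleThreeTwo i (Fin.natAdd 3 x))) =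
      ![![a, b, c, d, e] (shuffleThreeTwo i 3), ![a, b, c, d, e] (shuffleThreeTwo i 4)] := by
    ext x; fin_cases x <;> rfl
  have hsign (i : Fin 10) : Equiv.Perm.sign (α := Fin (3 + 2)) (shuffleThreeTwo i) =
      (![1, -1, 1, 1, -1, 1, -1, 1, -1, 1] : Fin 10 → ℤˣ) i := sign_shuffleThreeTwo i
  simp only [hα, hβ, hsign]
  simp [Fin.sum_univ_succ, shuffleThreeTwo]
  ring

theorem wedge_three_three_apply {V : Type*} [AddCommGroup V] [Module ℝ V]
    (α : AlternatingMap ℝ V ℝ (Fin 3)) (β : AlternatingMap ℝ V ℝ (Fin 3))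
    (a b c d e f : V) :
    wedge α β ![a, b, c, d, e, f] =
      α ![a, b, c] * β ![d, e, f] - α ![a, b, d] * β ![c, e, f] + α ![a, b, e] * β ![c, d, f]
      - α ![a, b, f] * β ![c, d, e] + α ![a, c, d] * β ![b, e, f] - α ![a, c, e] * β ![b, d, f]
      + α ![a, c, f] * β ![b, d, e] + α ![a, d, e] * β ![b, c, f] - α ![a, d, f] * β ![b, c, e]
      + α ![a, e, f] * β ![b, c, d] - α ![b, c, d] * β ![a, e, f] + α ![b, c, e] * β ![a, d, f]
      - α ![b, c, f] * β ![a, d, e] - α ![b, d, e] * β ![a, c, f] + α ![b, d, f] * β ![a, c, e]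
      - α ![b, e, f] * β ![a, c, d] + α ![c, d, e] * β ![a, b, f] - α ![c, d, f] * β ![a, b, e]
      + α ![c, e, f] * β ![a, b, d] - α ![d, e, f] * β ![a, b, c] := by
  rw [wedge_apply_eq_sum α β shuffleThreeThree (by decide) (by decide)]
  have hα (i : Fin 20) : (fun x ↦ ![a, b, c, d, e, f] (shuffleThreeThree i (Fin.castAdd 3 x))) =
      ![![a, b, c, d, e, f] (shuffleThreeThree i 0), ![a, b, c, d, e, f] (shuffleThreeThree i 1),
        ![a, b, c, d, e, f] (shuffleThreeThree i 2)] := by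
    ext x; fin_cases x <;> rfl
  have hβ (i : Fin 20) : (fun x ↦ ![a, b, c, d, e, f] (shuffleThreeThree i (Fin.natAdd 3 x))) =
      ![![a, b, c, d, e, f] (shuffleThreeThree i 3), ![a, b, c, d, e, f] (shuffleThreeThree i 4),
        ![a, b, c, d, e, f] (shuffleThreeThree i 5)] := by
    ext x; fin_cases x <;> rfl
  have hsign (i : Fin 20) : Equiv.Perm.sign (α := Fin (3 + 3)) (shuffleThreeThree i) =
      (![1, -1, 1, -1, 1, -1, 1, 1, -1, 1, -1, 1, -1, -1, 1, -1, 1, -1, 1,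
        -1] : Fin 20 → ℤˣ) i := sign_shuffleThreeThree i
  simp only [hα, hβ, hsign]
  simp [Fin.sum_univ_succ, shuffleThreeThree]
  ring

theorem exists_hyperbolic_pair {K V : Type*} [Field K] [AddCommGroup V] [Module K V]
    [FiniteDimensional K V] (B : LinearMap.BilinForm K V) (hB : B.IsAlt) (W : Submodule K V)
    (hW : ∀ x ∈ W, (∀ y ∈ W, B x y = 0) → x = 0) (hpos : 0 < finrank K W) :
    ∃ p ∈ W, ∃ q ∈ W, B p q = 1 ∧ ∃ W' ≤ W, (∀ x ∈ W', B p x = 0 ∧ B q x = 0) ∧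
      (∀ x ∈ W', (∀ y ∈ W', B x y = 0) → x = 0) ∧ finrank K W ≤ finrank K W' + 2 := by
  have hne : W ≠ ⊥ := by rintro rfl; simp at hpos
  obtain ⟨p, hp, hp0⟩ := W.ne_bot_iff.mp hne
  obtain ⟨q, hq, hpq⟩ : ∃ q ∈ W, B p q ≠ 0 := by
    by_contra! h
    exact hp0 (hW p hp h)
  obtain ⟨q, hq, hpq⟩ : ∃ q ∈ W, B p q = 1 :=
    ⟨(B p q)⁻¹ • q, W.smul_mem _ hq, by simp [hpq]⟩
  let φ : W →ₗ[K] K × K := ((B p).prod (B q)).comp W.subtype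
  have hmem (x : V) : x ∈ φ.ker.map W.subtype ↔ x ∈ W ∧ B p x = 0 ∧ B q x = 0 := by
    simp [φ, and_left_comm]
  have hqp : B q p = -1 := by rw [← hB.neg_eq p q, hpq]
  refine ⟨p, hp, q, hq, hpq, φ.ker.map W.subtype, fun x hx ↦ ((hmem x).1 hx).1,
    fun x hx ↦ ((hmem x).1 hx).2, fun x hx h ↦ ?_, ?_⟩
  · obtain ⟨hxW, hpx, hqx⟩ := (hmem x).1 hx
    have hxp : B x p = 0 := by rw [← hB.neg_eq p x, hpx, neg_zero]
    have hxq : B x q = 0 := by rw [← hB.neg_eq q x, hqx, neg_zero]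
    refine hW x hxW fun y hy ↦ ?_
    have := h (y - B p y • q + B q y • p) ((hmem _).2
      ⟨W.add_mem (W.sub_mem hy (W.smul_mem _ hq)) (W.smul_mem _ hp), by simp [hpq, hB p],
        by simp [hqp, hB q]⟩)
    simpa [hxp, hxq] using this
  · have h1 := φ.finrank_range_add_finrank_ker
    have h2 : finrank K φ.range ≤ 2 := by simpa using φ.range.finrank_le
    have h3 : finrank K (φ.ker.map W.subtype) = finrank K φ.ker :=
      LinearEquiv.finrank_eq (Submodule.equivMapOfInjective _ W.injective_subtype _).symm
    omega

theorem exists_darboux_basis {K V : Type*} [Field K] [AddCommGroup V] [Module K V]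
    [FiniteDimensional K V] (B : LinearMap.BilinForm K V) (hB : B.IsAlt)
    (hnd : ∀ x, (∀ y, B x y = 0) → x = 0) (hdim : finrank K V = 6) :
    ∃ b : Basis (Fin 6) K V,
      B (b 0) (b 1) = 1 ∧ B (b 2) (b 3) = 1 ∧ B (b 4) (b 5) = 1 ∧
      B (b 0) (b 2) = 0 ∧ B (b 0) (b 3) = 0 ∧ B (b 0) (b 4) = 0 ∧ B (b 0) (b 5) = 0 ∧
      B (b 1) (b 2) = 0 ∧ B (b 1) (b 3) = 0 ∧ B (b 1) (b 4) = 0 ∧ B (b 1) (b 5) = 0 ∧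
      B (b 2) (b 4) = 0 ∧ B (b 2) (b 5) = 0 ∧ B (b 3) (b 4) = 0 ∧ B (b 3) (b 5) = 0 := by
  obtain ⟨p, -, q, -, hpq, W, -, hW, hWnd, hWdim⟩ := exists_hyperbolic_pair B hB ⊤
    (fun x _ h ↦ hnd x fun y ↦ h y trivial) (by simp [hdim])
  rw [finrank_top, hdim] at hWdim
  obtain ⟨r, hr, s, hs, hrs, U, hUW, hU, hUnd, hUdim⟩ := exists_hyperbolic_pair B hB W hWnd
    (by omega)
  obtain ⟨u, hu, v, hv, huv, -⟩ := exists_hyperbolic_pair B hB U hUnd (by omega)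
  have hli : LinearIndependent K ![p, q, r, s, u, v] := by
    rw [Fintype.linearIndependent_iff]
    intro g hg
    have key (y : V) := congrArg (fun x ↦ B y x) hg
    have neg (x y : V) : B y x = - B x y := (hB.neg_eq x y).symm
    simp only [Fin.sum_univ_six, map_add, map_smul, map_zero, smul_eq_mul] at key
    have hru := hU u hu
    have hrv := hU v hv
    have hpr := hW r hr
    have hps := hW s hs
    have hpu := hW u (hUW hu)
    have hpv := hW v (hUW hv)
    have self (x : V) : B x x = 0 := hB x
    have h0 := key q
    have h1 := key p
    have h2 := key s
    have h3 := key r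
    have h4 := key v
    have h5 := key u
    simp [self, hpr, hps, hpu, hpv, hru, hrv, hpq, hrs, huv, neg p, neg q, neg r, neg s,
      neg u v] at h0 h1 h2 h3 h4 h5
    intro i
    fin_cases i <;> assumption
  refine ⟨basisOfLinearIndependentOfCardEqFinrank hli (by simp [hdim]), ?_⟩
  simp [hpq, hrs, huv, hW r hr, hW s hs, hW u (hUW hu), hW v (hUW hv), hU u hu, hU v hv]

/-- Alternating forms are determined by their values on the strictly increasing
families of vectors of a basis, and these values are arbitrary. -/
noncomputable def alternatingCoordEquiv {V I : Type*} [AddCommGroup V] [Module ℝ V]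
    [LinearOrder I] (b : Basis I ℝ V) (n : ℕ) :
    AlternatingMap ℝ V ℝ (Fin n) ≃ₗ[ℝ] ((Fin n ↪o I) → ℝ) :=
  exteriorPower.alternatingMapLinearEquiv ≪≫ₗ ((b.exteriorPower n).constr ℝ).symm ≪≫ₗ
    LinearEquiv.funCongrLeft ℝ ℝ Set.powersetCard.ofFinEmbEquiv

theorem alternatingCoordEquiv_apply {V I : Type*} [AddCommGroup V] [Module ℝ V]
    [LinearOrder I] (b : Basis I ℝ V) (n : ℕ) (η : AlternatingMap ℝ V ℝ (Fin n))
    (f : Fin n ↪o I) : alternatingCoordEquiv b n η f = η (fun i ↦ b (f i)) := by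
  simp [alternatingCoordEquiv, LinearEquiv.funCongrLeft_apply, LinearMap.funLeft_apply,
    Basis.constr, exteriorPower.ιMulti_family, Function.comp_def]

theorem alternating_ext_orderEmb {V I : Type*} [AddCommGroup V] [Module ℝ V]
    [LinearOrder I] (b : Basis I ℝ V) {n : ℕ} {η : AlternatingMap ℝ V ℝ (Fin n)}
    (h : ∀ f : Fin n ↪o I, η (fun i ↦ b (f i)) = 0) : η = 0 :=
  (alternatingCoordEquiv b n).injective <| by
    ext f
    simp [alternatingCoordEquiv_apply, h]

theorem three_form_eq_zero {V : Type*} [AddCommGroup V] [Module ℝ V] (b : Basis (Fin 6) ℝ V)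
    {η : AlternatingMap ℝ V ℝ (Fin 3)}
    (h : ∀ i j k, i < j → j < k → η ![b i, b j, b k] = 0) : η = 0 := by
  refine alternating_ext_orderEmb b fun f ↦ ?_
  rw [← h (f 0) (f 1) (f 2) (f.strictMono (by decide)) (f.strictMono (by decide))]
  congr 1
  ext i
  fin_cases i <;> rfl

theorem orderEmb_fin_eq_succAbove {n : ℕ} (f : Fin n ↪o Fin (n + 1)) :
    ∃ i, f = Fin.succAboveOrderEmb i := by
  have hcard : (Finset.univ.map f.toEmbedding)ᶜ.card = 1 := by
    simp [Finset.card_compl]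
  obtain ⟨i, hi⟩ := Finset.card_eq_one.mp hcard
  refine ⟨i, ?_⟩
  apply DFunLike.coe_injective
  have hr : Set.range f = {i}ᶜ := by
    have := congrArg (fun s : Finset _ ↦ (s : Set (Fin (n+1)))ᶜ) hi
    simpa using this
  exact (f.strictMono.range_inj (Fin.strictMono_succAbove i)).1 (by simp [hr])

theorem forall_lt_lt_fin_six (P : Fin 6 → Fin 6 → Fin 6 → Prop)
    (h : P 0 1 2 ∧ P 0 1 3 ∧ P 0 1 4 ∧ P 0 1 5 ∧
      P 0 2 3 ∧ P 0 2 4 ∧ P 0 2 5 ∧ P 0 3 4 ∧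
      P 0 3 5 ∧ P 0 4 5 ∧ P 1 2 3 ∧ P 1 2 4 ∧
      P 1 2 5 ∧ P 1 3 4 ∧ P 1 3 5 ∧ P 1 4 5 ∧
      P 2 3 4 ∧ P 2 3 5 ∧ P 2 4 5 ∧ P 3 4 5) :
    ∀ i j k, i < j → j < k → P i j k := by
  simpa [Fin.forall_fin_succ, and_assoc] using h

theorem update_vec₂₀ {α : Type*} (x y u : α) :
    Function.update ![x, y] 0 u = ![u, y] := by
  funext i
  fin_cases i <;> rfl

theorem update_vec₂₁ {α : Type*} (x y u : α) :
    Function.update ![x, y] 1 u = ![x, u] := by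
  funext i
  fin_cases i <;> rfl

theorem update_vec₃₀ {α : Type*} (x y z u : α) :
    Function.update ![x, y, z] 0 u = ![u, y, z] := by
  funext i
  fin_cases i <;> rfl

theorem update_vec₃₁ {α : Type*} (x y z u : α) :
    Function.update ![x, y, z] 1 u = ![x, u, z] := by
  funext i
  fin_cases i <;> rfl

theorem update_vec₃₂ {α : Type*} (x y z u : α) :
    Function.update ![x, y, z] 2 u = ![x, y, u] := by
  funext i
  fin_cases i <;> rfl

theorem exists_three_form {V : Type*} [AddCommGroup V] [Module ℝ V] (b : Basis (Fin 6) ℝ V)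
    (g : Fin 6 → Fin 6 → Fin 6 → ℝ) :
    ∃ η : AlternatingMap ℝ V ℝ (Fin 3),
      ∀ i j k, i < j → j < k → η ![b i, b j, b k] = g i j k := by
  refine ⟨(alternatingCoordEquiv b 3).symm fun f ↦ g (f 0) (f 1) (f 2), fun i j k hij hjk ↦ ?_⟩
  have hf : StrictMono ![i, j, k] := by
    simp [Fin.strictMono_iff_lt_succ, Fin.forall_fin_succ, hij, hjk]
  have h := alternatingCoordEquiv_apply b 3
    ((alternatingCoordEquiv b 3).symm fun f ↦
      g (f 0) (f 1) (f 2)) (OrderEmbedding.ofStrictMono _ hf)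
  rw [LinearEquiv.apply_symm_apply] at h
  simp only [OrderEmbedding.coe_ofStrictMono] at h
  refine Eq.trans (congrArg _ ?_) h.symm
  ext x
  fin_cases x <;> rfl

theorem five_form_eq_zero {V : Type*} [AddCommGroup V] [Module ℝ V] (b : Basis (Fin 6) ℝ V)
    {η : AlternatingMap ℝ V ℝ (Fin 5)}
    (h : ∀ i : Fin 6, η (fun j ↦ b (i.succAbove j)) = 0) : η = 0 := by
  refine alternating_ext_orderEmb b fun f ↦ ?_
  obtain ⟨i, rfl⟩ := orderEmb_fin_eq_succAbove f
  exact h i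

/-- The contraction of a three-form with the Poisson bivector of a Darboux basis, in coordinates. -/
noncomputable def darbouxContraction {V : Type*} [AddCommGroup V] [Module ℝ V] (b : Fin 6 → V) :
    AlternatingMap ℝ V ℝ (Fin 3) →ₗ[ℝ] Fin 6 → ℝ where
  toFun ω := ![ω ![b 0, b 2, b 3] + ω ![b 0, b 4, b 5],
      ω ![b 1, b 2, b 3] + ω ![b 1, b 4, b 5],
      ω ![b 0, b 1, b 2] + ω ![b 2, b 4, b 5],
      ω ![b 0, b 1, b 3] + ω ![b 3, b 4, b 5],
      ω ![b 0, b 1, b 4] + ω ![b 2, b 3, b 4],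
      ω ![b 0, b 1, b 5] + ω ![b 2, b 3, b 5]]
  map_add' ω ω' := by
    ext i
    fin_cases i <;> simp <;> ring
  map_smul' r ω := by
    ext i
    fin_cases i <;> simp <;> ring

theorem darbouxContraction_surjective {V : Type*} [AddCommGroup V] [Module ℝ V]
    (b : Basis (Fin 6) ℝ V) : Function.Surjective (darbouxContraction b) := by
  intro t
  obtain ⟨ω, hω⟩ := exists_three_form b fun i j k ↦
      if i = 0 ∧ j = 2 ∧ k = 3 then t 0 else
      if i = 1 ∧ j = 2 ∧ k = 3 then t 1 else
      if i = 0 ∧ j = 1 ∧ k = 2 then t 2 else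
      if i = 0 ∧ j = 1 ∧ k = 3 then t 3 else
      if i = 0 ∧ j = 1 ∧ k = 4 then t 4 else
      if i = 0 ∧ j = 1 ∧ k = 5 then t 5 else 0
  refine ⟨ω, ?_⟩
  ext i
  fin_cases i <;> simp [darbouxContraction, hω]

theorem darbouxContraction_apply {V : Type*} [AddCommGroup V] [Module ℝ V]
    (b : Fin 6 → V) (ω : AlternatingMap ℝ V ℝ (Fin 3)) :
    darbouxContraction b ω = ![ω ![b 0, b 2, b 3] + ω ![b 0, b 4, b 5],
      ω ![b 1, b 2, b 3] + ω ![b 1, b 4, b 5],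
      ω ![b 0, b 1, b 2] + ω ![b 2, b 4, b 5],
      ω ![b 0, b 1, b 3] + ω ![b 3, b 4, b 5],
      ω ![b 0, b 1, b 4] + ω ![b 2, b 3, b 4],
      ω ![b 0, b 1, b 5] + ω ![b 2, b 3, b 5]] := rfl

theorem wedge_eq_zero_iff_darbouxContraction {V : Type*} [AddCommGroup V] [Module ℝ V]
    (b : Basis (Fin 6) ℝ V) (Ω : AlternatingMap ℝ V ℝ (Fin 2))
    (hΩ : Ω ![b 0, b 1] = 1 ∧ Ω ![b 2, b 3] = 1 ∧ Ω ![b 4, b 5] = 1 ∧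
      Ω ![b 0, b 2] = 0 ∧ Ω ![b 0, b 3] = 0 ∧ Ω ![b 0, b 4] = 0 ∧ Ω ![b 0, b 5] = 0 ∧
      Ω ![b 1, b 2] = 0 ∧ Ω ![b 1, b 3] = 0 ∧ Ω ![b 1, b 4] = 0 ∧ Ω ![b 1, b 5] = 0 ∧
      Ω ![b 2, b 4] = 0 ∧ Ω ![b 2, b 5] = 0 ∧ Ω ![b 3, b 4] = 0 ∧ Ω ![b 3, b 5] = 0)
    (ω : AlternatingMap ℝ V ℝ (Fin 3)) :
    wedge ω Ω = 0 ↔ darbouxContraction b ω = 0 := by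
  obtain ⟨h01, h23, h45, h02, h03, h04, h05, h12, h13, h14, h15, h24, h25, h34, h35⟩ := hΩ
  have key (i : Fin 6) : wedge ω Ω (fun j ↦ b (i.succAbove j)) =
      darbouxContraction b ω ((![1, 0, 3, 2, 5, 4] : Fin 6 → Fin 6) i) := by
    have hv : (fun j ↦ b (i.succAbove j)) = ![b (i.succAbove 0), b (i.succAbove 1),
        b (i.succAbove 2), b (i.succAbove 3), b (i.succAbove 4)] := by
      ext j
      fin_cases j <;> rfl
    rw [hv, wedge_three_two_apply]
    fin_cases i <;> simp [darbouxContraction_apply, Fin.succAbove, h01, h23, h45, h02, h03, h04,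
      h05, h12, h13, h14, h15, h24, h25, h34, h35, add_comm]
  constructor
  · intro h
    ext i
    have hi := key ((![1, 0, 3, 2, 5, 4] : Fin 6 → Fin 6) i)
    rw [h] at hi
    fin_cases i <;> exact hi.symm
  · intro h
    refine five_form_eq_zero b fun i ↦ ?_
    rw [key i, h]
    rfl

theorem exists_separating_effective_form {V : Type*} [AddCommGroup V] [Module ℝ V]
    (b : Basis (Fin 6) ℝ V) (ω : AlternatingMap ℝ V ℝ (Fin 3)) (hω : darbouxContraction b ω = 0) :
    ∃ ω', darbouxContraction b ω' = 0 ∧ (wedge ω ω' = 0 → ω = 0) := by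
  let J : V →ₗ[ℝ] V := b.constr ℝ ![b 1, -b 0, b 3, -b 2, b 5, -b 4]
  have J0 : J (b 0) = b 1 := by simp [J]
  have J1 : J (b 1) = -b 0 := by simp [J]
  have J2 : J (b 2) = b 3 := by simp [J]
  have J3 : J (b 3) = -b 2 := by simp [J]
  have J4 : J (b 4) = b 5 := by simp [J]
  have J5 : J (b 5) = -b 4 := by simp [J]
  have hJ (x y z : V) : ω.compLinearMap J ![x, y, z] = ω ![J x, J y, J z] := by
    rw [AlternatingMap.compLinearMap_apply]
    congr 1
    ext i
    fin_cases i <;> rfl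
  have neg₀ (x y z : V) : ω ![-x, y, z] = -ω ![x, y, z] := by
    simpa only [update_vec₃₀, update_vec₃₁, update_vec₃₂]
      using ω.map_update_neg ![x, y, z] 0 x
  have neg₁ (x y z : V) : ω ![x, -y, z] = -ω ![x, y, z] := by
    simpa only [update_vec₃₀, update_vec₃₁, update_vec₃₂]
      using ω.map_update_neg ![x, y, z] 1 y
  have neg₂ (x y z : V) : ω ![x, y, -z] = -ω ![x, y, z] := by
    simpa only [update_vec₃₀, update_vec₃₁, update_vec₃₂]
      using ω.map_update_neg ![x, y, z] 2 z
  have swap₀ (x y z : V) : ω ![y, x, z] = -ω ![x, y, z] := by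
    rw [← ω.map_swap ![x, y, z] (i := 0) (j := 1) (by decide)]
    congr 1
    ext i
    fin_cases i <;> rfl
  have swap₁ (x y z : V) : ω ![x, z, y] = -ω ![x, y, z] := by
    rw [← ω.map_swap ![x, y, z] (i := 1) (j := 2) (by decide)]
    congr 1
    ext i
    fin_cases i <;> rfl
  have e0 := congrFun hω 0
  have e1 := congrFun hω 1
  have e2 := congrFun hω 2
  have e3 := congrFun hω 3
  have e4 := congrFun hω 4
  have e5 := congrFun hω 5
  simp only [darbouxContraction_apply, Pi.zero_apply, Matrix.cons_val] at e0 e1 e2 e3 e4 e5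
  refine ⟨ω.compLinearMap J, ?_, fun h ↦ ?_⟩
  · ext i
    fin_cases i <;>
      simp [darbouxContraction_apply, hJ, J0, J1, J2, J3, J4, J5, neg₀, neg₁, neg₂,
        swap₀ (b 0) (b 1), swap₀ (b 2) (b 3),
        swap₁ _ (b 2) (b 3), swap₁ _ (b 4) (b 5)] <;>
      linarith
  · have h6 := wedge_three_three_apply ω (ω.compLinearMap J) (b 0) (b 1) (b 2) (b 3) (b 4) (b 5)
    simp only [h, AlternatingMap.zero_apply, hJ, J0, J1, J2, J3, J4, J5, neg₀, neg₁, neg₂,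
      swap₀ (b 0) (b 1), swap₀ (b 2) (b 3),
      swap₁ _ (b 2) (b 3), swap₁ _ (b 4) (b 5)] at h6
    replace e0 : ω ![b 0, b 4, b 5] = -ω ![b 0, b 2, b 3] := by linarith
    replace e1 : ω ![b 1, b 4, b 5] = -ω ![b 1, b 2, b 3] := by linarith
    replace e2 : ω ![b 2, b 4, b 5] = -ω ![b 0, b 1, b 2] := by linarith
    replace e3 : ω ![b 3, b 4, b 5] = -ω ![b 0, b 1, b 3] := by linarith
    replace e4 : ω ![b 2, b 3, b 4] = -ω ![b 0, b 1, b 4] := by linarith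
    replace e5 : ω ![b 2, b 3, b 5] = -ω ![b 0, b 1, b 5] := by linarith
    rw [e0, e1, e2, e3, e4, e5] at h6
    have hsum : 2 * ω ![b 0, b 1, b 2] ^ 2 + 2 * ω ![b 0, b 1, b 3] ^ 2 +
      2 * ω ![b 0, b 1, b 4] ^ 2 + 2 * ω ![b 0, b 1, b 5] ^ 2 + 2 * ω ![b 0, b 2, b 3] ^ 2 +
      ω ![b 0, b 2, b 4] ^ 2 + ω ![b 0, b 2, b 5] ^ 2 + ω ![b 0, b 3, b 4] ^ 2 +
      ω ![b 0, b 3, b 5] ^ 2 + 2 * ω ![b 1, b 2, b 3] ^ 2 + ω ![b 1, b 2, b 4] ^ 2 +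
      ω ![b 1, b 2, b 5] ^ 2 + ω ![b 1, b 3, b 4] ^ 2 + ω ![b 1, b 3, b 5] ^ 2 = 0 := by
      linear_combination -h6
    have q012 := sq_nonneg (ω ![b 0, b 1, b 2])
    have q013 := sq_nonneg (ω ![b 0, b 1, b 3])
    have q014 := sq_nonneg (ω ![b 0, b 1, b 4])
    have q015 := sq_nonneg (ω ![b 0, b 1, b 5])
    have q023 := sq_nonneg (ω ![b 0, b 2, b 3])
    have q024 := sq_nonneg (ω ![b 0, b 2, b 4])
    have q025 := sq_nonneg (ω ![b 0, b 2, b 5])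
    have q034 := sq_nonneg (ω ![b 0, b 3, b 4])
    have q035 := sq_nonneg (ω ![b 0, b 3, b 5])
    have q123 := sq_nonneg (ω ![b 1, b 2, b 3])
    have q124 := sq_nonneg (ω ![b 1, b 2, b 4])
    have q125 := sq_nonneg (ω ![b 1, b 2, b 5])
    have q134 := sq_nonneg (ω ![b 1, b 3, b 4])
    have q135 := sq_nonneg (ω ![b 1, b 3, b 5])
    have zero_of_sq (x : Fin 3 → V) (hx : ω x ^ 2 ≤ 0) : ω x = 0 :=
      pow_eq_zero_iff two_ne_zero |>.1 (le_antisymm hx (sq_nonneg _))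
    have z012 := zero_of_sq ![b 0, b 1, b 2] (by linarith)
    have z013 := zero_of_sq ![b 0, b 1, b 3] (by linarith)
    have z014 := zero_of_sq ![b 0, b 1, b 4] (by linarith)
    have z015 := zero_of_sq ![b 0, b 1, b 5] (by linarith)
    have z023 := zero_of_sq ![b 0, b 2, b 3] (by linarith)
    have z024 := zero_of_sq ![b 0, b 2, b 4] (by linarith)
    have z025 := zero_of_sq ![b 0, b 2, b 5] (by linarith)
    have z034 := zero_of_sq ![b 0, b 3, b 4] (by linarith)
    have z035 := zero_of_sq ![b 0, b 3, b 5] (by linarith)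
    have z123 := zero_of_sq ![b 1, b 2, b 3] (by linarith)
    have z124 := zero_of_sq ![b 1, b 2, b 4] (by linarith)
    have z125 := zero_of_sq ![b 1, b 2, b 5] (by linarith)
    have z134 := zero_of_sq ![b 1, b 3, b 4] (by linarith)
    have z135 := zero_of_sq ![b 1, b 3, b 5] (by linarith)
    simp only [z023, z123, z012, z013, z014, z015, neg_zero] at e0 e1 e2 e3 e4 e5
    refine three_form_eq_zero b (forall_lt_lt_fin_six (fun i j k ↦ ω ![b i, b j, b k] = 0) ?_)
    exact ⟨z012, z013, z014, z015, z023, z024, z025, z034, z035, e0, z123, z124, z125, z134,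
      z135, e1, e4, e5, e2, e3⟩

/-- The effective 3-forms on a symplectic `(V, Ω)` of dimension 6 form a linear
subspace of dimension 14, on which the pairing `Θ` defined by
`ω∧ω′ = Θ(ω,ω′)·θ` (with `θ = −(1/6)·Ω∧Ω∧Ω`) is nondegenerate. -/
theorem effective_three_forms_symplectic_subspace
    {V : Type*} [AddCommGroup V] [Module ℝ V] [FiniteDimensional ℝ V]
    (hdim : Module.finrank ℝ V = 6)
    (Ω : AlternatingMap ℝ V ℝ (Fin 2))
    (hnd : ∀ X : V, (∀ Y : V, Ω ![X, Y] = 0) → X = 0)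
    (Θ : AlternatingMap ℝ V ℝ (Fin 3) → AlternatingMap ℝ V ℝ (Fin 3) → ℝ)
    (hΘ : ∀ ω ω' : AlternatingMap ℝ V ℝ (Fin 3),
      wedge ω ω' = Θ ω ω' • ((-(6 : ℝ)⁻¹) • wedge Ω (wedge Ω Ω))) :
    ∃ E : Submodule ℝ (AlternatingMap ℝ V ℝ (Fin 3)),
      (∀ ω, ω ∈ E ↔ wedge ω Ω = 0) ∧
      Module.finrank ℝ E = 14 ∧
      ∀ ω ∈ E, ω ≠ 0 → ∃ ω' ∈ E, Θ ω ω' ≠ 0 := by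
  let B : LinearMap.BilinForm ℝ V := LinearMap.mk₂ ℝ (fun x y ↦ Ω ![x, y])
    (fun x x' y ↦ by simpa only [update_vec₂₀, update_vec₂₁] using Ω.map_update_add ![x, y] 0 x x')
    (fun r x y ↦ by simpa only [update_vec₂₀, update_vec₂₁] using Ω.map_update_smul ![x, y] 0 r x)
    (fun x y y' ↦ by simpa only [update_vec₂₀, update_vec₂₁] using Ω.map_update_add ![x, y] 1 y y')
    (fun r x y ↦ by simpa only [update_vec₂₀, update_vec₂₁] using Ω.map_update_smul ![x, y] 1 r y)
  have hB : B.IsAlt := fun x ↦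
    Ω.map_eq_zero_of_eq ![x, x] (i := 0) (j := 1) rfl (by decide)
  obtain ⟨b, hb⟩ := exists_darboux_basis B hB hnd hdim
  have hE := wedge_eq_zero_iff_darbouxContraction b Ω hb
  refine ⟨(darbouxContraction b).ker, fun ω ↦ by rw [LinearMap.mem_ker, hE], ?_, ?_⟩
  · have h3 : finrank ℝ (AlternatingMap ℝ V ℝ (Fin 3)) = 20 := by
      rw [exteriorPower.alternatingMapLinearEquiv.finrank_eq, Subspace.dual_finrank_eq,
        exteriorPower.finrank_eq, hdim]
      rfl
    have : FiniteDimensional ℝ (AlternatingMap ℝ V ℝ (Fin 3)) :=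
      FiniteDimensional.of_finrank_pos (by omega)
    have h := (darbouxContraction b).finrank_range_add_finrank_ker
    rw [LinearMap.range_eq_top.2 (darbouxContraction_surjective b), finrank_top, h3,
      finrank_fin_fun] at h
    omega
  · intro ω hω hne
    obtain ⟨ω', hω', h⟩ := exists_separating_effective_form b ω hω
    refine ⟨ω', hω', fun h0 ↦ hne (h ?_)⟩
    rw [hΘ, h0]
    exact zero_smul ℝ (-(6 : ℝ)⁻¹ • wedge Ω (wedge Ω Ω))
end

section
/- Let C₁, C₂, C₃ be smooth (C^∞) maps from an open neighborhood U of 0 in ℝ³ to the m×m real matrices, satisfying the zero-curvature conditions ∂Cᵢ/∂xⱼ − ∂Cⱼ/∂xᵢ + CᵢCⱼ − CⱼCᵢ = 0 on U for all i, j ∈ {1,2,3}. Then there exist an open neighborhood U′ ⊆ U of 0 and a smooth map G : U′ → GL(m,ℝ) with G(0) = Id such that ∂G/∂xᵢ = Cᵢ·G on U′ for i = 1,2,3 (equivalently (∂G/∂xᵢ)·G⁻¹ = Cᵢ). -/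
section FlatConnection

open Set Metric Filter Topology
open scoped ContDiff NNReal

variable {E 𝔸 : Type*} [NormedAddCommGroup E] [NormedSpace ℝ E]
  [NormedRing 𝔸] [NormedAlgebra ℝ 𝔸]

/-- A uniform quadratic Taylor estimate, from a Lipschitz bound on the derivative. -/
theorem norm_sub_sub_fderiv_le_of_lipschitzOnWith {F : Type*} [NormedAddCommGroup F]
    [NormedSpace ℝ F] {f : E → F} {s : Set E} {K : ℝ≥0} (hs : Convex ℝ s)
    (hf : ∀ x ∈ s, DifferentiableAt ℝ f x) (hK : LipschitzOnWith K (fderiv ℝ f) s)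
    {x y : E} (hx : x ∈ s) (hy : y ∈ s) :
    ‖f y - f x - fderiv ℝ f x (y - x)‖ ≤ K * ‖y - x‖ ^ 2 := by
  have key := (hs.inter (convex_closedBall x ‖y - x‖)).norm_image_sub_le_of_norm_fderiv_le'
    (f := f) (φ := fderiv ℝ f x) (C := K * ‖y - x‖) (x := x) (y := y)
    (fun z hz => hf z hz.1) (fun z hz => ?_) ⟨hx, by simp⟩ ⟨hy, by simp [dist_eq_norm]⟩
  · rwa [mul_assoc, ← sq] at key
  · refine (hK.norm_sub_le hz.1 hx).trans ?_
    gcongr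
    simpa [dist_eq_norm] using hz.2

/-- A function that is `C²` at `0` is bounded, with bounded and Lipschitz derivative, on
arbitrarily small balls. -/
theorem exists_ball_bounds {F : Type*} [NormedAddCommGroup F] [NormedSpace ℝ F] {f : E → F}
    {U : Set E} (hU : U ∈ 𝓝 0) (hf : ContDiffAt ℝ 2 f 0) (c : ℝ) :
    ∃ M : ℝ≥0, ∃ ρ > 0, ρ ≤ 1 ∧ M * ρ * c ≤ 1 ∧ ball 0 ρ ⊆ U ∧
      (∀ y ∈ ball 0 ρ, DifferentiableAt ℝ f y ∧ ‖f y‖ ≤ M ∧ ‖fderiv ℝ f y‖ ≤ M) ∧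
      LipschitzOnWith M (fderiv ℝ f) (ball 0 ρ) := by
  have hf' : ContDiffAt ℝ 1 (fderiv ℝ f) 0 := hf.fderiv_right (by norm_num)
  obtain ⟨K, s, hs, hK⟩ := hf'.exists_lipschitzOnWith
  set M : ℝ≥0 := K + (‖f 0‖₊ + 1) + (‖fderiv ℝ f 0‖₊ + 1) with hM
  have h1 : ∀ᶠ y in 𝓝 (0 : E), ‖f y‖ < M :=
    hf.continuousAt.norm.eventually_lt_const (by
      simp only [hM, NNReal.coe_add, coe_nnnorm, NNReal.coe_one]
      have := K.coe_nonneg; have := norm_nonneg (fderiv ℝ f 0); linarith)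
  have h2 : ∀ᶠ y in 𝓝 (0 : E), ‖fderiv ℝ f y‖ < M :=
    hf'.continuousAt.norm.eventually_lt_const (by
      simp only [hM, NNReal.coe_add, coe_nnnorm, NNReal.coe_one]
      have := K.coe_nonneg; have := norm_nonneg (f 0); linarith)
  have h3 : ∀ᶠ y in 𝓝 (0 : E), ContDiffAt ℝ 2 f y := hf.eventually (by simp)
  obtain ⟨ε, hε, hball⟩ := Metric.eventually_nhds_iff_ball.1
    (((h1.and h2).and h3).and ((eventually_mem_set.2 hs).and (eventually_mem_set.2 hU)))
  have hpos : 0 < M * |c| + 1 := by positivity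
  set ρ : ℝ := min ε (min 1 (M * |c| + 1)⁻¹) with hρ
  have hsub : ball (0 : E) ρ ⊆ ball 0 ε := ball_subset_ball (min_le_left _ _)
  have hρ0 : 0 < ρ := by positivity
  refine ⟨M, ρ, hρ0, (min_le_right _ _).trans (min_le_left _ _), ?_,
    fun y hy => (hball y (hsub hy)).2.2, fun y hy => ?_, ?_⟩
  · have h : ρ ≤ (M * |c| + 1)⁻¹ := (min_le_right _ _).trans (min_le_right _ _)
    calc (M : ℝ) * ρ * c ≤ M * ρ * |c| := by gcongr; exact le_abs_self c
      _ = ρ * (M * |c|) := by ring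
      _ ≤ (M * |c| + 1)⁻¹ * (M * |c| + 1) := by gcongr; linarith
      _ = 1 := inv_mul_cancel₀ hpos.ne'
  · obtain ⟨⟨⟨ha, hb⟩, hc⟩, -⟩ := hball y (hsub hy)
    exact ⟨hc.differentiableAt (by norm_num), ha.le, hb.le⟩
  · refine (hK.mono fun y hy => (hball y (hsub hy)).2.1).weaken ?_
    rw [hM, add_assoc]; exact le_self_add

/-- Existence of parallel transport along rays from the origin. -/
theorem exists_radial_transport [CompleteSpace 𝔸] {θ : E → E →L[ℝ] 𝔸} {M : ℝ≥0} {ρ : ℝ}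
    (hρM : M * ρ * (‖(1 : 𝔸)‖ + 1) ≤ 1) (hc : ContinuousOn θ (ball 0 ρ))
    (hM : ∀ y ∈ ball 0 ρ, ‖θ y‖ ≤ M) {x : E} (hx : x ∈ ball 0 ρ) :
    ∃ g : ℝ → 𝔸, g 0 = 1 ∧
      ∀ t ∈ Icc (0 : ℝ) 1, HasDerivWithinAt g (θ (t • x) x * g t) (Icc 0 1) t := by
  have hmem : ∀ t ∈ Icc (0 : ℝ) 1, t • x ∈ ball (0 : E) ρ := fun t ht =>
    (convex_ball (0 : E) ρ).smul_mem_of_zero_mem (mem_ball_self (pos_of_mem_ball hx)) hx ht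
  have hxρ : ‖x‖ ≤ ρ := (mem_ball_zero_iff.1 hx).le
  have hA : ∀ t ∈ Icc (0 : ℝ) 1, ‖θ (t • x) x‖ ≤ M * ρ := fun t ht =>
    ((θ (t • x)).le_of_opNorm_le (hM _ (hmem t ht)) x).trans (by gcongr)
  have hρ : 0 ≤ ρ := (norm_nonneg x).trans hxρ
  have hpl : IsPicardLindelof (fun t a => θ (t • x) x * a) (tmin := 0) (tmax := 1)
      ⟨0, by simp⟩ (1 : 𝔸) 1 0 1 (M * ⟨ρ, hρ⟩) := by
    refine ⟨fun t ht => ?_, fun a _ => ?_, fun t ht a ha => ?_, by simp⟩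
    · refine LipschitzOnWith.of_dist_le_mul fun a _ b _ => ?_
      rw [dist_eq_norm, ← mul_sub, dist_eq_norm]
      refine (norm_mul_le _ _).trans ?_
      gcongr
      exact hA t ht
    · refine ContinuousOn.mul (ContinuousOn.clm_apply ?_ continuousOn_const) continuousOn_const
      exact hc.comp (by fun_prop) hmem
    · have ha' : ‖a‖ ≤ ‖(1 : 𝔸)‖ + 1 := by
        have := norm_le_norm_add_norm_sub' a 1
        have h2 : ‖a - 1‖ ≤ 1 := by simpa [dist_eq_norm] using ha
        linarith
      calc ‖θ (t • x) x * a‖ ≤ ‖θ (t • x) x‖ * ‖a‖ := norm_mul_le _ _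
        _ ≤ M * ρ * (‖(1 : 𝔸)‖ + 1) := by
          gcongr
          exact hA t ht
        _ ≤ 1 := hρM
  exact hpl.exists_eq_forall_mem_Icc_hasDerivWithinAt₀

/-- First order expansion of the transport equation in the end point. The first order term of the
defect vanishes because the curvature does, expressed here by `hflat`. -/
theorem norm_transport_defect_le {a b p q d r g : 𝔸} {t M B η : ℝ}
    (ht : t ∈ Icc (0 : ℝ) 1) (hη1 : η ≤ 1)
    (hb : ‖b‖ ≤ M * η) (hq : ‖q‖ ≤ M * η) (hd : ‖d‖ ≤ M * η ^ 2) (hr : ‖r‖ ≤ M * η ^ 2)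
    (hg : ‖g‖ ≤ B) (hflat : p - q + b * a - a * b = 0) (hM : 0 ≤ M) (hη : 0 ≤ η) :
    ‖a * g + (b * g + t • (p * g + b * (a * g))) -
      (a + b + t • q + t • d + r) * (g + t • (b * g))‖ ≤
      (2 * M ^ 2 * B + 2 * (M * (B + M * B))) * η ^ 2 := by
  have hB : 0 ≤ B := (norm_nonneg g).trans hg
  have hp : p = q + a * b - b * a := by
    rw [← sub_eq_zero, ← hflat]; abel
  have hsm : ∀ z : 𝔸, ‖t • z‖ ≤ ‖z‖ := fun z => by
    rw [norm_smul, Real.norm_of_nonneg ht.1]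
    exact mul_le_of_le_one_left (norm_nonneg _) ht.2
  have hbg : ‖b * g‖ ≤ M * η * B := (norm_mul_le _ _).trans (by gcongr)
  have hu : ‖g + t • (b * g)‖ ≤ B + M * B := by
    refine (norm_add_le _ _).trans (add_le_add hg ((hsm _).trans (hbg.trans ?_)))
    gcongr
    exact mul_le_of_le_one_right hM hη1
  have e : a * g + (b * g + t • (p * g + b * (a * g))) -
      (a + b + t • q + t • d + r) * (g + t • (b * g)) =
      -(t • (b * (b * g)) + t • t • (q * (b * g)) + t • (d * (g + t • (b * g)))
        + r * (g + t • (b * g))) := by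
    subst hp
    simp only [mul_add, add_mul, sub_mul, smul_mul_assoc, mul_smul_comm, mul_assoc]
    module
  rw [e, norm_neg]
  have n1 : ‖t • (b * (b * g))‖ ≤ M * η * (M * η * B) :=
    (hsm _).trans ((norm_mul_le _ _).trans (by gcongr))
  have n2 : ‖t • t • (q * (b * g))‖ ≤ M * η * (M * η * B) :=
    (hsm _).trans ((hsm _).trans ((norm_mul_le _ _).trans (by gcongr)))
  have n3 : ‖t • (d * (g + t • (b * g)))‖ ≤ M * η ^ 2 * (B + M * B) :=
    (hsm _).trans ((norm_mul_le _ _).trans (by gcongr))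
  have n4 : ‖r * (g + t • (b * g))‖ ≤ M * η ^ 2 * (B + M * B) :=
    (norm_mul_le _ _).trans (by gcongr)
  refine norm_add₄_le.trans ((add_le_add (add_le_add (add_le_add n1 n2) n3) n4).trans_eq ?_)
  ring

/-- A solution of the flat linear total differential equation `dG = θ G` with smooth `θ` is
smooth. -/
theorem contDiffOn_of_hasFDerivAt_linear {θ : E → E →L[ℝ] 𝔸} {G : E → 𝔸} {s : Set E}
    (hs : IsOpen s) (hθ : ContDiffOn ℝ ∞ θ s)
    (hG : ∀ x ∈ s, HasFDerivAt G ((ContinuousLinearMap.mul ℝ 𝔸).flip (G x) ∘L θ x) x) :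
    ContDiffOn ℝ ∞ G s := by
  rw [contDiffOn_infty]
  intro n
  induction n with
  | zero => exact contDiffOn_zero.2 fun x hx => (hG x hx).continuousAt.continuousWithinAt
  | succ n ih =>
    push_cast
    rw [contDiffOn_succ_iff_fderiv_of_isOpen hs]
    refine ⟨fun x hx => (hG x hx).differentiableAt.differentiableWithinAt, by simp, ?_⟩
    refine ContDiffOn.congr ?_ fun x hx => (hG x hx).fderiv
    exact ((ContinuousLinearMap.mul ℝ 𝔸).flip.contDiff.comp_contDiffOn ih).clm_comp
      (hθ.of_le (by exact_mod_cast le_top))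


/-- Parallel transport along rays from the origin of a flat connection form is a primitive of it. -/
theorem hasFDerivAt_radial_transport {θ : E → E →L[ℝ] 𝔸} {M : ℝ≥0} {ρ : ℝ} {g : E → ℝ → 𝔸}
    (hρ1 : ρ ≤ 1) (hd : ∀ y ∈ ball 0 ρ, DifferentiableAt ℝ θ y)
    (hM : ∀ y ∈ ball 0 ρ, ‖θ y‖ ≤ M) (hM' : ∀ y ∈ ball 0 ρ, ‖fderiv ℝ θ y‖ ≤ M)
    (hL : LipschitzOnWith M (fderiv ℝ θ) (ball 0 ρ))
    (hflat : ∀ y ∈ ball 0 ρ, ∀ u v : E,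
      fderiv ℝ θ y v u - fderiv ℝ θ y u v + θ y u * θ y v - θ y v * θ y u = 0)
    (hg0 : ∀ x ∈ ball 0 ρ, g x 0 = 1)
    (hg : ∀ x ∈ ball 0 ρ, ∀ t ∈ Icc (0 : ℝ) 1,
      HasDerivWithinAt (g x) (θ (t • x) x * g x t) (Icc 0 1) t)
    {x : E} (hx : x ∈ ball 0 ρ) :
    HasFDerivAt (fun y => g y 1) ((ContinuousLinearMap.mul ℝ 𝔸).flip (g x 1) ∘L θ x) x := by
  have hmem : ∀ y ∈ ball (0 : E) ρ, ∀ t ∈ Icc (0 : ℝ) 1, t • y ∈ ball (0 : E) ρ := fun y hy t ht =>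
    (convex_ball (0 : E) ρ).smul_mem_of_zero_mem (mem_ball_self (pos_of_mem_ball hy)) hy ht
  have hle1 : ∀ y ∈ ball (0 : E) ρ, ‖y‖ ≤ 1 := fun y hy => (mem_ball_zero_iff.1 hy).le.trans hρ1
  have hM0 : (0 : ℝ) ≤ M := M.coe_nonneg
  have hcont : ∀ y ∈ ball (0 : E) ρ, ContinuousOn (g y) (Icc 0 1) := fun y hy t ht =>
    (hg y hy t ht).continuousWithinAt
  obtain ⟨B, hB⟩ := isCompact_Icc.exists_bound_of_continuousOn (hcont x hx)
  have hIci : ∀ {f : ℝ → 𝔸} {f' : 𝔸} {t : ℝ}, t ∈ Ico (0 : ℝ) 1 →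
      HasDerivWithinAt f f' (Icc 0 1) t → HasDerivWithinAt f f' (Ici t) t := fun ht h =>
    h.mono_of_mem_nhdsWithin (mem_of_superset (Icc_mem_nhdsGE ht.2)
      (Icc_subset_Icc_left ht.1))
  set D : ℝ := 2 * (M : ℝ) ^ 2 * B + 2 * (M * (B + M * B))
  rw [hasFDerivAt_iff_isLittleO_nhds_zero]
  refine Asymptotics.IsBigO.trans_isLittleO (g := fun h : E => ‖h‖ ^ 2) ?_
    (Asymptotics.isLittleO_norm_pow_id one_lt_two)
  refine Asymptotics.IsBigO.of_bound (D / (M + 1) * (Real.exp (M + 1) - 1)) ?_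
  have hnear : ∀ᶠ h in 𝓝 (0 : E), x + h ∈ ball (0 : E) ρ :=
    (continuous_const.add continuous_id).continuousAt.eventually_mem
      (isOpen_ball.mem_nhds (by simpa using hx))
  filter_upwards [hnear, Metric.ball_mem_nhds (0 : E) one_pos] with h hxh hh1
  have hh1 : ‖h‖ ≤ 1 := (mem_ball_zero_iff.1 hh1).le
  set φ : ℝ → 𝔸 := fun t => g x t + t • (θ (t • x) h * g x t) with hφ
  have hφ' : ∀ t ∈ Icc (0 : ℝ) 1, HasDerivWithinAt φ
      (θ (t • x) x * g x t + (θ (t • x) h * g x t +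
        t • (fderiv ℝ θ (t • x) x h * g x t + θ (t • x) h * (θ (t • x) x * g x t))))
      (Icc 0 1) t := by
    intro t ht
    have h1 : HasDerivAt (fun s : ℝ => θ (s • x)) (fderiv ℝ θ (t • x) x) t := by
      have h2 : HasDerivAt (fun s : ℝ => s • x) x t := by
        simpa using (hasDerivAt_id t).smul_const x
      exact (hd _ (hmem x hx t ht)).hasFDerivAt.comp_hasDerivAt t h2
    have h3 : HasDerivAt (fun s : ℝ => θ (s • x) h) (fderiv ℝ θ (t • x) x h) t := by
      simpa using h1.clm_apply (hasDerivAt_const t h)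
    have h4 := (hg x hx t ht).add
      ((hasDerivWithinAt_id t (Icc 0 1)).smul (h3.hasDerivWithinAt.mul (hg x hx t ht)))
    refine h4.congr_deriv ?_
    simp only [id, one_smul]
    abel
  have hgron := dist_le_of_approx_trajectories_ODE_of_mem (K := M + 1) (a := 0) (b := 1)
    (v := fun t z => θ (t • (x + h)) (x + h) * z) (s := fun _ => univ)
    (f := φ) (g := g (x + h)) (εf := D * ‖h‖ ^ 2) (εg := 0) (δ := 0)
    (fun t ht => LipschitzOnWith.of_dist_le_mul fun a _ b _ => ?_)
    (fun t ht => (hφ' t ht).continuousWithinAt)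
    (fun t ht => hIci ht (hφ' t (Ico_subset_Icc_self ht)))
    (fun t ht => ?_) (fun _ _ => mem_univ _) (hcont _ hxh)
    (fun t ht => hIci ht (hg _ hxh t (Ico_subset_Icc_self ht))) (fun t _ => by simp)
    (fun _ _ => mem_univ _) (by simp [hφ, hg0 x hx, hg0 _ hxh]) 1 (by simp)
  · rw [gronwallBound_of_K_ne_0 (by positivity), dist_comm, dist_eq_norm] at hgron
    simp only [hφ, one_smul, zero_mul, zero_add, add_zero, sub_zero, mul_one] at hgron
    rw [← sub_sub] at hgron
    refine hgron.trans_eq ?_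
    rw [Real.norm_of_nonneg (by positivity)]
    push_cast
    ring
  · rw [dist_eq_norm, ← mul_sub, dist_eq_norm]
    refine (norm_mul_le _ _).trans ?_
    gcongr
    refine ((θ _).le_of_opNorm_le (hM _ (hmem _ hxh t (Ico_subset_Icc_self ht))) _).trans ?_
    push_cast
    nlinarith [hle1 _ hxh, norm_nonneg (x + h)]
  · have ht' := Ico_subset_Icc_self ht
    have hy := hmem x hx t ht'
    have hy' := hmem _ hxh t ht'
    set r : E →L[ℝ] 𝔸 := θ (t • (x + h)) - θ (t • x) - fderiv ℝ θ (t • x) (t • (x + h) - t • x)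
      with hr
    have hrn : ‖r‖ ≤ M * ‖h‖ ^ 2 := by
      refine (norm_sub_sub_fderiv_le_of_lipschitzOnWith (convex_ball _ _) hd hL hy hy').trans ?_
      have : ‖t • (x + h) - t • x‖ ≤ ‖h‖ := by
        rw [← smul_sub, add_sub_cancel_left, norm_smul, Real.norm_of_nonneg ht'.1]
        exact mul_le_of_le_one_left (norm_nonneg _) ht'.2
      gcongr
    have hsplit : θ (t • (x + h)) (x + h) = θ (t • x) x + θ (t • x) h +
        t • fderiv ℝ θ (t • x) h x + t • fderiv ℝ θ (t • x) h h + r (x + h) := by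
      have : θ (t • (x + h)) = θ (t • x) + t • fderiv ℝ θ (t • x) h + r := by
        rw [hr, ← smul_sub, add_sub_cancel_left, map_smul]; abel
      rw [this]
      simp only [add_apply, smul_apply, map_add]
      module
    rw [dist_eq_norm, hsplit]
    have hq : ∀ v : E, ‖fderiv ℝ θ (t • x) h v‖ ≤ M * ‖h‖ * ‖v‖ := fun v =>
      (fderiv ℝ θ (t • x) h).le_of_opNorm_le
        ((fderiv ℝ θ (t • x)).le_of_opNorm_le (hM' _ hy) h) v
    refine norm_transport_defect_le ht' hh1 ((θ _).le_of_opNorm_le (hM _ hy) h)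
      ((hq x).trans (mul_le_of_le_one_right (by positivity) (hle1 x hx)))
      ((hq h).trans_eq (by ring))
      ((r.le_of_opNorm_le hrn _).trans (mul_le_of_le_one_right (by positivity) (hle1 _ hxh)))
      (hB t ht') (hflat _ hy h x) hM0 (norm_nonneg h)

/-- **Flat connections integrate locally**, for connection forms with values in a Banach algebra. -/
theorem exists_local_primitive_of_flat [CompleteSpace 𝔸] {θ : E → E →L[ℝ] 𝔸} {U : Set E}
    (hU : IsOpen U) (h0 : (0 : E) ∈ U) (hθ : ContDiffOn ℝ ∞ θ U)
    (hflat : ∀ y ∈ U, ∀ u v : E,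
      fderiv ℝ θ y v u - fderiv ℝ θ y u v + θ y u * θ y v - θ y v * θ y u = 0) :
    ∃ V : Set E, IsOpen V ∧ 0 ∈ V ∧ V ⊆ U ∧ ∃ G : E → 𝔸, ContDiffOn ℝ ∞ G V ∧ G 0 = 1 ∧
      (∀ x ∈ V, IsUnit (G x)) ∧
      ∀ x ∈ V, HasFDerivAt G ((ContinuousLinearMap.mul ℝ 𝔸).flip (G x) ∘L θ x) x := by
  have hU0 := hU.mem_nhds h0
  obtain ⟨M, ρ, hρ, hρ1, hρM, hρU, hb, hL⟩ := exists_ball_bounds hU0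
    (contDiffAt_infty.1 (hθ.contDiffAt hU0) 2) (‖(1 : 𝔸)‖ + 1)
  have hex : ∀ x ∈ ball (0 : E) ρ, ∃ g : ℝ → 𝔸, g 0 = 1 ∧
      ∀ t ∈ Icc (0 : ℝ) 1, HasDerivWithinAt g (θ (t • x) x * g t) (Icc 0 1) t := fun x hx =>
    exists_radial_transport hρM (hθ.continuousOn.mono hρU) (fun y hy => (hb y hy).2.1) hx
  choose! g hg0 hg using hex
  have hG : ∀ x ∈ ball (0 : E) ρ, HasFDerivAt (fun y => g y 1)
      ((ContinuousLinearMap.mul ℝ 𝔸).flip (g x 1) ∘L θ x) x := fun x hx =>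
    hasFDerivAt_radial_transport hρ1 (fun y hy => (hb y hy).1) (fun y hy => (hb y hy).2.1)
      (fun y hy => (hb y hy).2.2) hL (fun y hy => hflat y (hρU hy)) hg0 hg hx
  have hmem0 : (0 : E) ∈ ball (0 : E) ρ := mem_ball_self hρ
  have hG0 : g 0 1 = 1 := by
    have h := constant_of_derivWithin_zero (f := g 0) (a := 0) (b := 1)
      (fun t ht => (hg 0 hmem0 t ht).differentiableWithinAt)
      (fun t ht => by
        have ht' := Ico_subset_Icc_self ht
        rw [(hg 0 hmem0 t ht').derivWithin (uniqueDiffOn_Icc one_pos t ht')]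
        simp) 1 (by simp)
    rw [h, hg0 0 hmem0]
  have hc : ContinuousOn (fun y => g y 1) (ball 0 ρ) := fun x hx =>
    (hG x hx).continuousAt.continuousWithinAt
  refine ⟨ball 0 ρ ∩ (fun y => g y 1) ⁻¹' {a | IsUnit a},
    hc.isOpen_inter_preimage isOpen_ball Units.isOpen, ⟨hmem0, by simp [hG0]⟩,
    fun x hx => hρU hx.1, fun y => g y 1, ?_, hG0, fun x hx => hx.2, fun x hx => hG x hx.1⟩
  exact (contDiffOn_of_hasFDerivAt_linear isOpen_ball (hθ.mono hρU) hG).mono inter_subset_left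

/-- Coordinate version of `exists_local_primitive_of_flat`. -/
theorem exists_local_primitive_of_zero_curvature {ι : Type*} [Fintype ι] [DecidableEq ι]
    [CompleteSpace 𝔸] {C : ι → (ι → ℝ) → 𝔸} {U : Set (ι → ℝ)} (hU : IsOpen U)
    (h0 : (0 : ι → ℝ) ∈ U) (hC : ∀ i, ContDiffOn ℝ ∞ (C i) U)
    (hcurv : ∀ i j, ∀ x ∈ U, fderiv ℝ (C i) x (Pi.single j 1) - fderiv ℝ (C j) x (Pi.single i 1)
      + C i x * C j x - C j x * C i x = 0) :
    ∃ V : Set (ι → ℝ), IsOpen V ∧ 0 ∈ V ∧ V ⊆ U ∧ ∃ G : (ι → ℝ) → 𝔸,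
      ContDiffOn ℝ ∞ G V ∧ G 0 = 1 ∧ (∀ x ∈ V, IsUnit (G x)) ∧
      ∀ i, ∀ x ∈ V, fderiv ℝ G x (Pi.single i 1) = C i x * G x := by
  set L : ι → 𝔸 →L[ℝ] (ι → ℝ) →L[ℝ] 𝔸 := fun i =>
    ContinuousLinearMap.smulRightL ℝ (ι → ℝ) 𝔸 (ContinuousLinearMap.proj i)
  have hLa : ∀ i a u, L i a u = u i • a := fun i a u => rfl
  have hθ : ContDiffOn ℝ ∞ (fun x => ∑ i, L i (C i x)) U :=
    ContDiffOn.sum fun i _ => (L i).contDiff.comp_contDiffOn (hC i)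
  have hflat : ∀ y ∈ U, ∀ u v : ι → ℝ,
      fderiv ℝ (fun x => ∑ i, L i (C i x)) y v u - fderiv ℝ (fun x => ∑ i, L i (C i x)) y u v
        + (∑ i, L i (C i y)) u * (∑ i, L i (C i y)) v
        - (∑ i, L i (C i y)) v * (∑ i, L i (C i y)) u = 0 := by
    intro y hy u v
    have hd : ∀ i, DifferentiableAt ℝ (C i) y := fun i =>
      ((hC i).contDiffAt (hU.mem_nhds hy)).differentiableAt (by simp)
    have hfd : HasFDerivAt (fun x => ∑ i, L i (C i x)) (∑ i, L i ∘L fderiv ℝ (C i) y) y :=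
      HasFDerivAt.fun_sum fun i _ => (L i).hasFDerivAt.comp y (hd i).hasFDerivAt
    have hexp : ∀ i w, fderiv ℝ (C i) y w = ∑ j, w j • fderiv ℝ (C i) y (Pi.single j 1) := by
      intro i w
      conv_lhs => rw [pi_eq_sum_univ' w, map_sum]
      simp only [map_smul]
    have key : ∑ i, ∑ j, (u i * v j) • (fderiv ℝ (C i) y (Pi.single j 1)
        - fderiv ℝ (C j) y (Pi.single i 1) + C i y * C j y - C j y * C i y) = 0 :=
      Finset.sum_eq_zero fun i _ => Finset.sum_eq_zero fun j _ => by rw [hcurv i j y hy, smul_zero]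
    rw [hfd.fderiv, ← key]
    simp only [FunLike.coe_sum, Finset.sum_apply, ContinuousLinearMap.comp_apply, hLa]
    have e1 : ∑ i, u i • fderiv ℝ (C i) y v =
        ∑ i, ∑ j, (u i * v j) • fderiv ℝ (C i) y (Pi.single j 1) := by
      simp only [hexp _ v, Finset.smul_sum, smul_smul]
    have e2 : ∑ i, v i • fderiv ℝ (C i) y u =
        ∑ i, ∑ j, (u i * v j) • fderiv ℝ (C j) y (Pi.single i 1) := by
      simp only [hexp _ u, Finset.smul_sum, smul_smul]
      rw [Finset.sum_comm]
      simp only [mul_comm]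
    have e3 : (∑ i, u i • C i y) * ∑ i, v i • C i y = ∑ i, ∑ j, (u i * v j) • (C i y * C j y) := by
      simp only [Finset.sum_mul_sum, smul_mul_smul_comm]
    have e4 : (∑ i, v i • C i y) * ∑ i, u i • C i y = ∑ i, ∑ j, (u i * v j) • (C j y * C i y) := by
      simp only [Finset.sum_mul_sum, smul_mul_smul_comm]
      rw [Finset.sum_comm]
      simp only [mul_comm]
    rw [e1, e2, e3, e4]
    simp only [smul_sub, smul_add, Finset.sum_sub_distrib, Finset.sum_add_distrib]
  obtain ⟨V, hV, hV0, hVU, G, hGs, hG1, hGu, hG⟩ := exists_local_primitive_of_flat hU h0 hθ hflat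
  refine ⟨V, hV, hV0, hVU, G, hGs, hG1, hGu, fun i x hx => ?_⟩
  rw [(hG x hx).fderiv]
  simp [hLa, Pi.single_apply]

end FlatConnection

section MatrixEntries

open scoped Matrix.Norms.Operator

variable {E m n : Type*} [NormedAddCommGroup E] [NormedSpace ℝ E] [Fintype m] [Fintype n]

theorem Matrix.contDiffOn_iff_entries [DecidableEq m] [DecidableEq n] {F : E → Matrix m n ℝ}
    {s : Set E} {k : WithTop ℕ∞} :
    ContDiffOn ℝ k F s ↔ ∀ i j, ContDiffOn ℝ k (fun x => F x i j) s := by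
  refine ⟨fun h i j => ?_, fun h => ?_⟩
  · exact (LinearMap.toContinuousLinearMap
      (Matrix.entryLinearMap ℝ ℝ i j : Matrix m n ℝ →ₗ[ℝ] ℝ)).contDiff.comp_contDiffOn h
  · have : F = fun x => ∑ i, ∑ j, F x i j • Matrix.single i j (1 : ℝ) := by
      funext x
      conv_lhs => rw [Matrix.matrix_eq_sum_single (F x)]
      simp
    rw [this]
    exact ContDiffOn.sum fun i _ => ContDiffOn.sum fun j _ => (h i j).smul contDiffOn_const

theorem Matrix.fderiv_entry_apply {F : E → Matrix m n ℝ} {x : E} (h : DifferentiableAt ℝ F x)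
    (i : m) (j : n) (v : E) : fderiv ℝ (fun y => F y i j) x v = fderiv ℝ F x v i j := by
  have := (LinearMap.toContinuousLinearMap
    (Matrix.entryLinearMap ℝ ℝ i j : Matrix m n ℝ →ₗ[ℝ] ℝ)).hasFDerivAt.comp x h.hasFDerivAt
  exact congrArg (fun T : E →L[ℝ] ℝ => T v) this.fderiv

end MatrixEntries

/-- **Flat connections integrate locally.**  If smooth matrix-valued functions
`C₁, C₂, C₃` on a neighborhood `U` of `0` in `ℝ³` satisfy the zero-curvature equations
`∂Cᵢ/∂xⱼ − ∂Cⱼ/∂xᵢ + CᵢCⱼ − CⱼCᵢ = 0`, then on some smaller neighborhood `U′` of `0`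
there is a smooth invertible-matrix-valued `G` with `G 0 = 1` and `∂G/∂xᵢ = Cᵢ·G`. -/
theorem local_solution_of_zero_curvature {m : ℕ}
    (U : Set (Fin 3 → ℝ)) (hU : IsOpen U) (h0 : (0 : Fin 3 → ℝ) ∈ U)
    (C : Fin 3 → (Fin 3 → ℝ) → Matrix (Fin m) (Fin m) ℝ)
    (hC : ∀ (i : Fin 3) (k l : Fin m), ContDiffOn ℝ (⊤ : ℕ∞) (fun x => C i x k l) U)
    (hcurv : ∀ (i j : Fin 3) (k l : Fin m), ∀ x ∈ U,
      fderiv ℝ (fun x => C i x k l) x (Pi.single j 1)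
        - fderiv ℝ (fun x => C j x k l) x (Pi.single i 1)
        + (C i x * C j x) k l - (C j x * C i x) k l = 0) :
    ∃ U' : Set (Fin 3 → ℝ), IsOpen U' ∧ (0 : Fin 3 → ℝ) ∈ U' ∧ U' ⊆ U ∧
      ∃ G : (Fin 3 → ℝ) → Matrix (Fin m) (Fin m) ℝ,
        (∀ k l : Fin m, ContDiffOn ℝ (⊤ : ℕ∞) (fun x => G x k l) U') ∧
        G 0 = 1 ∧
        (∀ x ∈ U', IsUnit (G x)) ∧
        (∀ (i : Fin 3) (k l : Fin m), ∀ x ∈ U',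
          fderiv ℝ (fun x => G x k l) x (Pi.single i 1) = (C i x * G x) k l) := by
  open scoped Matrix.Norms.Operator in
  have hC' : ∀ i, ContDiffOn ℝ (⊤ : ℕ∞) (C i) U := fun i =>
    Matrix.contDiffOn_iff_entries.2 (hC i)
  have hdiff : ∀ i, ∀ x ∈ U, DifferentiableAt ℝ (C i) x := fun i x hx =>
    ((hC' i).contDiffAt (hU.mem_nhds hx)).differentiableAt (by simp)
  obtain ⟨V, hV, hV0, hVU, G, hGs, hG1, hGu, hG⟩ :=
    exists_local_primitive_of_zero_curvature hU h0 hC' fun i j x hx => by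
      ext k l
      have h := hcurv i j k l x hx
      rw [Matrix.fderiv_entry_apply (hdiff i x hx), Matrix.fderiv_entry_apply (hdiff j x hx)] at h
      exact h
  refine ⟨V, hV, hV0, hVU, G, Matrix.contDiffOn_iff_entries.1 hGs, hG1, hGu, fun i k l x hx => ?_⟩
  exact (Matrix.fderiv_entry_apply
    ((hGs.contDiffAt (hV.mem_nhds hx)).differentiableAt (by simp)) k l _).trans
    (congrFun₂ (hG i x hx) k l)
end
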